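/- arXiv:1602.06894 — 2 statements merged into one kernel-verified Lean document; each statement's English description precedes it below -/
import Mathlib

section
/- Let P be a d-dimensional polytope with exactly d+3 vertices. Then the extension complexity of P equals the minimum of its number of vertices and its number of facets. Explicitly, xc(P) = d+3 unless P is combinatorially equivalent to the (d−3)-fold pyramid over the triangular prism Δ_1 × Δ_2, in which case xc(P) = d+2. -/
open Set

noncomputable section

/-- A polytope: the convex hull of a finite set of points. -/
def IsPolytope {N : ℕ} (P : Set (Fin N → ℝ)) : Prop :=
  ∃ S : Finset (Fin N → ℝ), P = convexHull ℝ (S : Set (Fin N → ℝ))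

/-- Dimension of a set: the dimension of its affine hull (with `-1` for the empty set). -/
def pdim {N : ℕ} (P : Set (Fin N → ℝ)) : ℤ :=
  haveI := Classical.dec P.Nonempty
  if P.Nonempty then (Module.finrank ℝ (affineSpan ℝ P).direction : ℤ) else -1

/-- `F` is a face of `P`: the subset of `P` where some linear functional bounded above on `P`
attains its maximum value.  This includes `∅` and `P` itself. -/
def IsFaceOf {N : ℕ} (F P : Set (Fin N → ℝ)) : Prop :=
  ∃ (c : Fin N → ℝ) (b : ℝ),
    (∀ x ∈ P, ∑ i, c i * x i ≤ b) ∧ F = {x ∈ P | ∑ i, c i * x i = b}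

/-- A facet: a face of dimension one less than the polytope. -/
def IsFacetOf {N : ℕ} (F P : Set (Fin N → ℝ)) : Prop :=
  IsFaceOf F P ∧ pdim F + 1 = pdim P

/-- A ridge: a face of dimension two less than the polytope. -/
def IsRidgeOf {N : ℕ} (F P : Set (Fin N → ℝ)) : Prop :=
  IsFaceOf F P ∧ pdim F + 2 = pdim P

def IsVertexOf {N : ℕ} (v : Fin N → ℝ) (P : Set (Fin N → ℝ)) : Prop :=
  IsFaceOf {v} P

def vertexSet {N : ℕ} (P : Set (Fin N → ℝ)) : Set (Fin N → ℝ) :=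
  {v | IsVertexOf v P}

def vertexCount {N : ℕ} (P : Set (Fin N → ℝ)) : ℕ := (vertexSet P).ncard

def facetCount {N : ℕ} (P : Set (Fin N → ℝ)) : ℕ := {F | IsFacetOf F P}.ncard

/-- Extension complexity: the minimal number of facets of a polytope (in any dimension)
admitting an affine projection onto `P`. -/
def xc {N : ℕ} (P : Set (Fin N → ℝ)) : ℕ :=
  sInf {n | ∃ (e : ℕ) (Q : Set (Fin e → ℝ)) (π : (Fin e → ℝ) →ᵃ[ℝ] (Fin N → ℝ)),
    IsPolytope Q ∧ π '' Q = P ∧ facetCount Q = n}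

/-- Combinatorial equivalence: an inclusion-preserving bijection between face lattices. -/
def CombEquiv {M N : ℕ} (P : Set (Fin M → ℝ)) (Q : Set (Fin N → ℝ)) : Prop :=
  ∃ φ : {F : Set (Fin M → ℝ) // IsFaceOf F P} ≃ {G : Set (Fin N → ℝ) // IsFaceOf G Q},
    ∀ F₁ F₂ : {F : Set (Fin M → ℝ) // IsFaceOf F P},
      F₁.1 ⊆ F₂.1 ↔ (φ F₁).1 ⊆ (φ F₂).1

/-- A full-dimensional `n`-simplex in `ℝ^n` with the origin in its (relative) interior. -/
def simplexF (n : ℕ) : Set (Fin n → ℝ) :=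
  convexHull ℝ ((Set.range fun i : Fin n => Pi.single i (1 : ℝ)) ∪ {fun _ => -1})

/-- The Cartesian product `Δ_n × Δ_m`, realized in `ℝ^{n+m}`. -/
def prodP (n m : ℕ) : Set (Fin (n + m) → ℝ) :=
  {z | ∃ a ∈ simplexF n, ∃ b ∈ simplexF m, z = Fin.append a b}

/-- The direct sum `Δ_n ⊕ Δ_m`, realized in `ℝ^{n+m}`. -/
def sumP (n m : ℕ) : Set (Fin (n + m) → ℝ) :=
  convexHull ℝ (((fun a : Fin n → ℝ => Fin.append a (0 : Fin m → ℝ)) '' simplexF n) ∪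
    ((fun b : Fin m → ℝ => Fin.append (0 : Fin n → ℝ) b) '' simplexF m))

/-- The join `A ⋆ B` of two polytopes, realized in `ℝ^{p+q+1}` with the two copies
placed in skew affine subspaces. -/
def joinP {p q : ℕ} (A : Set (Fin p → ℝ)) (B : Set (Fin q → ℝ)) :
    Set (Fin (p + q + 1) → ℝ) :=
  convexHull ℝ
    (((fun a : Fin p → ℝ =>
        Fin.append (Fin.append a (0 : Fin q → ℝ)) (fun _ : Fin 1 => (0 : ℝ))) '' A) ∪
     ((fun b : Fin q → ℝ =>
        Fin.append (Fin.append (0 : Fin p → ℝ) b) (fun _ : Fin 1 => (1 : ℝ))) '' B))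

/-- The canonical `k`-fold iterated pyramid over `X`, realized in `ℝ^{p+k}`. -/
def pyrK {p : ℕ} (k : ℕ) (X : Set (Fin p → ℝ)) : Set (Fin (p + k) → ℝ) :=
  convexHull ℝ (((fun x : Fin p → ℝ => Fin.append x (0 : Fin k → ℝ)) '' X) ∪
    Set.range (fun j : Fin k => Fin.append (0 : Fin p → ℝ) (Pi.single j (1 : ℝ))))

/-- Transport a subset of `ℝ^a` to `ℝ^b` along a proof that `a = b`. -/
def castSet {a b : ℕ} (h : a = b) (X : Set (Fin a → ℝ)) : Set (Fin b → ℝ) :=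
  (fun x : Fin a → ℝ => fun i : Fin b => x (Fin.cast h.symm i)) '' X

/-- Projective equivalence of two subsets of `ℝ^N`: `Q` is the image of `P` under a
projective transformation `x ↦ (A x + b) / (⟨c, x⟩ + δ)` whose associated
`(N+1) × (N+1)` matrix is invertible and whose denominator is positive on `P`. -/
def ProjEquiv {N : ℕ} (P Q : Set (Fin N → ℝ)) : Prop :=
  ∃ (A : (Fin N → ℝ) →ₗ[ℝ] (Fin N → ℝ)) (b c : Fin N → ℝ) (δ : ℝ),
    Function.Bijective
      (fun z : (Fin N → ℝ) × ℝ => (A z.1 + z.2 • b, (∑ i, c i * z.1 i) + δ * z.2)) ∧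
    (∀ x ∈ P, 0 < (∑ i, c i * x i) + δ) ∧
    Q = (fun x : Fin N → ℝ => ((∑ i, c i * x i) + δ)⁻¹ • (A x + b)) '' P

/-- `P` is a pyramid with base `B`: the convex hull of `B` and a point outside
the affine hull of `B`. -/
def IsPyramidOver {N : ℕ} (P B : Set (Fin N → ℝ)) : Prop :=
  ∃ a : Fin N → ℝ, a ∉ affineSpan ℝ B ∧ P = convexHull ℝ (B ∪ {a})

/-- `P` is a `k`-fold iterated pyramid over `B`. -/
def IsKFoldPyramidOver {N : ℕ} : ℕ → Set (Fin N → ℝ) → Set (Fin N → ℝ) → Prop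
  | 0, P, B => P = B
  | k + 1, P, B => ∃ P' : Set (Fin N → ℝ), IsPyramidOver P P' ∧ IsKFoldPyramidOver k P' B

/-- `P` is a pyramid: the convex hull of one of its facets together with one more vertex. -/
def IsPyramidPolytope {N : ℕ} (P : Set (Fin N → ℝ)) : Prop :=
  ∃ (F : Set (Fin N → ℝ)) (v : Fin N → ℝ),
    IsFacetOf F P ∧ IsVertexOf v P ∧ P = convexHull ℝ (F ∪ {v})

/-- A facet is pyramidal if it contains all vertices of the polytope but one. -/
def IsPyramidalFacet {N : ℕ} (F P : Set (Fin N → ℝ)) : Prop :=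
  IsFacetOf F P ∧ ∃ v, IsVertexOf v P ∧ v ∉ F ∧ ∀ w, IsVertexOf w P → w ≠ v → w ∈ F

/-- The projection `π_d : ℝ^{d+1} → ℝ^d` forgetting the last coordinate. -/
def projFun (d : ℕ) : (Fin (d + 1) → ℝ) → (Fin d → ℝ) :=
  fun x i => x i.castSucc

/-- `c` is an outer normal vector exposing the face `F` of `Q`. -/
def IsOuterNormal {N : ℕ} (Q F : Set (Fin N → ℝ)) (c : Fin N → ℝ) : Prop :=
  ∃ b : ℝ, (∀ x ∈ Q, ∑ i, c i * x i ≤ b) ∧ F = {x ∈ Q | ∑ i, c i * x i = b}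

/-- An upper facet: outer normal with positive last coordinate. -/
def IsUpperFacet {d : ℕ} (F Q : Set (Fin (d + 1) → ℝ)) : Prop :=
  IsFacetOf F Q ∧ ∃ c, IsOuterNormal Q F c ∧ 0 < c (Fin.last d)

/-- A lower facet: outer normal with negative last coordinate. -/
def IsLowerFacet {d : ℕ} (F Q : Set (Fin (d + 1) → ℝ)) : Prop :=
  IsFacetOf F Q ∧ ∃ c, IsOuterNormal Q F c ∧ c (Fin.last d) < 0

/-- A vertical facet: every outer normal has vanishing last coordinate. -/
def IsVerticalFacet {d : ℕ} (F Q : Set (Fin (d + 1) → ℝ)) : Prop :=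
  IsFacetOf F Q ∧ ∀ c, IsOuterNormal Q F c → c (Fin.last d) = 0

/-- An equatorial ridge: a ridge that is the intersection of an upper and a lower facet. -/
def IsEquatorialRidge {d : ℕ} (F Q : Set (Fin (d + 1) → ℝ)) : Prop :=
  IsRidgeOf F Q ∧ ∃ F₁ F₂ : Set (Fin (d + 1) → ℝ),
    IsUpperFacet F₁ Q ∧ IsLowerFacet F₂ Q ∧ F = F₁ ∩ F₂

/-- A face `F` of `Q` is preserved under the projection forgetting the last coordinate. -/
def PreservedFace {d : ℕ} (Q F : Set (Fin (d + 1) → ℝ)) : Prop :=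
  IsFaceOf (projFun d '' F) (projFun d '' Q) ∧ projFun d ⁻¹' (projFun d '' F) ∩ Q = F

/-- A face `F` of `Q` is strictly preserved: preserved and of the same dimension as its image. -/
def StrictlyPreservedFace {d : ℕ} (Q F : Set (Fin (d + 1) → ℝ)) : Prop :=
  PreservedFace Q F ∧ pdim (projFun d '' F) = pdim F

/-- A hexagon: a 2-dimensional polytope with exactly 6 vertices. -/
def IsHexagon {N : ℕ} (P : Set (Fin N → ℝ)) : Prop :=
  IsPolytope P ∧ pdim P = 2 ∧ vertexCount P = 6

/-- Three lines are concurrent: they share a common point, or they are pairwise parallel. -/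
def ConcurrentLines {N : ℕ} (L₁ L₂ L₃ : AffineSubspace ℝ (Fin N → ℝ)) : Prop :=
  (∃ x, x ∈ L₁ ∧ x ∈ L₂ ∧ x ∈ L₃) ∨
    (AffineSubspace.Parallel L₁ L₂ ∧ AffineSubspace.Parallel L₂ L₃ ∧
      AffineSubspace.Parallel L₁ L₃)

/-- A cyclic labeling of the vertices of a hexagon: consecutive points are joined by edges. -/
def CyclicLabeling {N : ℕ} (P : Set (Fin N → ℝ)) (p : Fin 6 → (Fin N → ℝ)) : Prop :=
  Function.Injective p ∧ Set.range p = vertexSet P ∧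
    ∀ i : Fin 6, IsFaceOf (segment ℝ (p i) (p (i + 1))) P

/-- A Desarguian hexagon. -/
def Desarguian {N : ℕ} (P : Set (Fin N → ℝ)) : Prop :=
  ∃ p : Fin 6 → (Fin N → ℝ), CyclicLabeling P p ∧
    ConcurrentLines (affineSpan ℝ {p 0, p 1}) (affineSpan ℝ {p 5, p 2})
      (affineSpan ℝ {p 3, p 4})

/-- A polytope is simplicial if every facet is a simplex. -/
def IsSimplicial {N : ℕ} (P : Set (Fin N → ℝ)) : Prop :=
  ∀ F : Set (Fin N → ℝ), IsFacetOf F P →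
    ∃ S : Finset (Fin N → ℝ),
      AffineIndependent ℝ (Subtype.val : {x // x ∈ S} → (Fin N → ℝ)) ∧
      F = convexHull ℝ (S : Set (Fin N → ℝ))

section Evaluation

variable {ι : Type*} {N : ℕ}

/-- Values at the points `v i` of the affine functional `x ↦ p.1 ⬝ x + p.2`. -/
def evalMap (v : ι → Fin N → ℝ) : ((Fin N → ℝ) × ℝ) →ₗ[ℝ] (ι → ℝ) where
  toFun p i := ∑ k, p.1 k * v i k + p.2
  map_add' p q := by
    ext i
    simp only [Prod.fst_add, Prod.snd_add, Pi.add_apply, add_mul, Finset.sum_add_distrib]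
    ring
  map_smul' r p := by
    ext i
    simp only [Prod.smul_fst, Prod.smul_snd, Pi.smul_apply, smul_eq_mul, RingHom.id_apply,
      mul_add, Finset.mul_sum, mul_assoc]

/-- The space of value vectors of affine functionals on the point family `v`. -/
def affEval (v : ι → Fin N → ℝ) : Submodule ℝ (ι → ℝ) := LinearMap.range (evalMap v)

theorem mem_affEval {v : ι → Fin N → ℝ} {w : ι → ℝ} :
    w ∈ affEval v ↔ ∃ (c : Fin N → ℝ) (b : ℝ), ∀ i, ∑ k, c k * v i k + b = w i := by
  constructor
  · rintro ⟨p, rfl⟩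
    exact ⟨p.1, p.2, fun i => rfl⟩
  · rintro ⟨c, b, h⟩
    exact ⟨(c, b), funext h⟩

theorem one_mem_affEval (v : ι → Fin N → ℝ) : (1 : ι → ℝ) ∈ affEval v :=
  mem_affEval.2 ⟨0, 1, fun i => by simp⟩

theorem affEval_comp_le {M : ℕ} (v : ι → Fin M → ℝ) (f : (Fin M → ℝ) →ᵃ[ℝ] (Fin N → ℝ)) :
    affEval (f ∘ v) ≤ affEval v := by
  intro w hw
  obtain ⟨c, b, h⟩ := mem_affEval.1 hw
  refine mem_affEval.2 ⟨fun j => ∑ k, c k * f.linear (Pi.single j 1) k,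
    ∑ k, c k * f 0 k + b, fun i => ?_⟩
  rw [← h i]
  have key : ∀ k, f (v i) k = ∑ j, f.linear (Pi.single j 1) k * v i j + f 0 k := by
    intro k
    have h1 : f (v i) = f.linear (v i) + f 0 := by
      have := f.map_vadd 0 (v i)
      simpa using this
    have h2 : v i = ∑ j, v i j • (Pi.single j (1 : ℝ) : Fin M → ℝ) := by
      ext t
      simp [Finset.sum_apply, Pi.single_apply]
    rw [h1]
    conv_lhs => rw [h2]
    simp [map_sum, Finset.sum_apply, mul_comm]
  simp only [Function.comp_apply, key, mul_add, Finset.sum_add_distrib, Finset.sum_mul,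
    Finset.mul_sum]
  rw [Finset.sum_comm]
  simp only [mul_assoc, add_assoc]

theorem mem_convexHull_range_iff {E : Type*} [AddCommGroup E] [Module ℝ E] [Fintype ι]
    (v : ι → E) (x : E) :
    x ∈ convexHull ℝ (range v) ↔
      ∃ w : ι → ℝ, (∀ i, 0 ≤ w i) ∧ ∑ i, w i = 1 ∧ ∑ i, w i • v i = x := by
  classical
  constructor
  · intro hx
    have hsub : range v ⊆ {x | ∃ w : ι → ℝ, (∀ i, 0 ≤ w i) ∧ ∑ i, w i = 1 ∧
        ∑ i, w i • v i = x} := by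
      rintro _ ⟨i, rfl⟩
      refine ⟨Pi.single i 1, fun j => ?_, by simp, by simp [Pi.single_apply, ite_smul]⟩
      by_cases h : j = i
      · subst h; simp
      · simp [h]
    refine convexHull_min hsub ?_ hx
    rintro _ ⟨w, hw, hw1, rfl⟩ _ ⟨u, hu, hu1, rfl⟩ a b ha hb hab
    refine ⟨fun i => a * w i + b * u i, fun i => ?_, ?_, ?_⟩
    · have := hw i; have := hu i; positivity
    · rw [Finset.sum_add_distrib, ← Finset.mul_sum, ← Finset.mul_sum, hw1, hu1]; linarith
    · simp only [add_smul, Finset.sum_add_distrib, mul_smul, Finset.smul_sum]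
  · rintro ⟨w, hw, hw1, rfl⟩
    exact (convex_convexHull ℝ _).sum_mem (fun i _ => hw i) hw1
      (fun i _ => subset_convexHull ℝ _ (mem_range_self i))

theorem affine_sum [Fintype ι] (v : ι → Fin N → ℝ) (w : ι → ℝ) (hw : ∑ i, w i = 1)
    (c : Fin N → ℝ) (b : ℝ) :
    ∑ k, c k * (∑ i, w i • v i) k + b = ∑ i, w i * (∑ k, c k * v i k + b) := by
  simp only [mul_add, Finset.sum_add_distrib, ← Finset.sum_mul, hw, one_mul, Finset.sum_apply,
    Pi.smul_apply, smul_eq_mul, Finset.mul_sum]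
  rw [Finset.sum_comm]
  congr 1
  exact Finset.sum_congr rfl fun i _ => Finset.sum_congr rfl fun k _ => by ring

theorem convexHull_range_sep_eq [Fintype ι] (v : ι → Fin N → ℝ) (c : Fin N → ℝ) (b : ℝ)
    (h : ∀ i, ∑ k, c k * v i k ≤ b) :
    {x ∈ convexHull ℝ (range v) | ∑ k, c k * x k = b} =
      convexHull ℝ (v '' {i | ∑ k, c k * v i k = b}) := by
  classical
  apply Subset.antisymm
  · rintro x ⟨hx, hxb⟩
    obtain ⟨w, hw, hw1, rfl⟩ := (mem_convexHull_range_iff v x).1 hx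
    have h0 := affine_sum v w hw1 c (-b)
    rw [hxb, add_neg_cancel] at h0
    have h1 : ∀ i, w i * (∑ k, c k * v i k + -b) = 0 := by
      have := (Finset.sum_eq_zero_iff_of_nonpos (s := Finset.univ)
        (f := fun i => w i * (∑ k, c k * v i k + -b)) (fun i _ =>
          mul_nonpos_of_nonneg_of_nonpos (hw i) (by linarith [h i]))).1 h0.symm
      exact fun i => this i (Finset.mem_univ i)
    have h2 : ∀ i, w i ≠ 0 → ∑ k, c k * v i k = b := by
      intro i hi
      rcases mul_eq_zero.1 (h1 i) with h | h
      · exact absurd h hi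
      · linarith
    rw [← Finset.sum_filter_of_ne (p := fun i => w i ≠ 0)
      (fun i _ hi h => hi (by simp [h]))]
    refine (convex_convexHull ℝ _).sum_mem (fun i _ => hw i) ?_ (fun i hi => ?_)
    · rw [Finset.sum_filter_of_ne (fun i _ hi => hi), hw1]
    · exact subset_convexHull ℝ _ ⟨i, h2 i (Finset.mem_filter.1 hi).2, rfl⟩
  · refine convexHull_min ?_ ?_
    · rintro _ ⟨i, hi, rfl⟩
      exact ⟨subset_convexHull ℝ _ (mem_range_self i), hi⟩
    · refine (convex_convexHull ℝ _).inter ?_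
      refine convex_hyperplane (f := fun x : Fin N → ℝ => ∑ k, c k * x k) ⟨fun x y => ?_,
        fun r x => ?_⟩ b
      · simp [mul_add, Finset.sum_add_distrib]
      · simp only [Pi.smul_apply, smul_eq_mul, Finset.mul_sum]
        exact Finset.sum_congr rfl fun k _ => by ring

theorem le_on_convexHull_range [Fintype ι] (v : ι → Fin N → ℝ) (c : Fin N → ℝ) (b : ℝ)
    (h : ∀ i, ∑ k, c k * v i k ≤ b) : ∀ x ∈ convexHull ℝ (range v), ∑ k, c k * x k ≤ b := by
  intro x hx
  obtain ⟨w, hw, hw1, rfl⟩ := (mem_convexHull_range_iff v x).1 hx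
  have h0 := affine_sum v w hw1 c (-b)
  have : ∑ i, w i * (∑ k, c k * v i k + -b) ≤ 0 := Finset.sum_nonpos fun i _ =>
    mul_nonpos_of_nonneg_of_nonpos (hw i) (by linarith [h i])
  linarith

/-- `Z` is the zero set of a nonnegative vector of `W`. -/
def IsZeroSet (W : Submodule ℝ (ι → ℝ)) (Z : Set ι) : Prop :=
  ∃ w ∈ W, (∀ i, 0 ≤ w i) ∧ Z = {i | w i = 0}

theorem isFaceOf_of_nonneg [Fintype ι] {v : ι → Fin N → ℝ} {w : ι → ℝ} (hw : w ∈ affEval v)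
    (h0 : ∀ i, 0 ≤ w i) :
    IsFaceOf (convexHull ℝ (v '' {i | w i = 0})) (convexHull ℝ (range v)) ∧
      {i | v i ∈ convexHull ℝ (v '' {i | w i = 0})} = {i | w i = 0} := by
  obtain ⟨c, b, h⟩ := mem_affEval.1 hw
  have e : ∀ i, w i = 0 ↔ ∑ k, -c k * v i k = b := by
    intro i
    rw [← h i]
    simp only [neg_mul, Finset.sum_neg_distrib]
    constructor <;> intro h <;> linarith
  have hle : ∀ i, ∑ k, -c k * v i k ≤ b := by
    intro i
    have := h0 i
    rw [← h i] at this
    simp only [neg_mul, Finset.sum_neg_distrib]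
    linarith
  have hs := convexHull_range_sep_eq v (fun k => -c k) b hle
  simp only [e]
  rw [← hs]
  refine ⟨⟨fun k => -c k, b, le_on_convexHull_range v _ b hle, rfl⟩, ?_⟩
  ext i
  simp only [mem_ofPred_eq, and_iff_right_iff_imp]
  exact fun _ => subset_convexHull ℝ _ (mem_range_self i)

theorem IsFaceOf.exists_nonneg [Fintype ι] {v : ι → Fin N → ℝ} {F : Set (Fin N → ℝ)}
    (hF : IsFaceOf F (convexHull ℝ (range v))) :
    ∃ w ∈ affEval v, (∀ i, 0 ≤ w i) ∧ {i | v i ∈ F} = {i | w i = 0} ∧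
      F = convexHull ℝ (v '' {i | w i = 0}) := by
  obtain ⟨c, b, hle, rfl⟩ := hF
  have hi : ∀ i, v i ∈ convexHull ℝ (range v) := fun i => subset_convexHull ℝ _ (mem_range_self i)
  refine ⟨fun i => b - ∑ k, c k * v i k, mem_affEval.2 ⟨fun k => -c k, b, fun i => ?_⟩,
    fun i => sub_nonneg.2 (hle _ (hi i)), ?_, ?_⟩
  · simp only [neg_mul, Finset.sum_neg_distrib]; ring
  · ext i
    simp only [mem_ofPred_eq, hi i, true_and, sub_eq_zero]
    exact eq_comm
  · rw [convexHull_range_sep_eq v c b fun i => hle _ (hi i)]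
    simp only [sub_eq_zero, @eq_comm _ b]

theorem finite_isFacetOf [Fintype ι] (v : ι → Fin N → ℝ) :
    {F | IsFacetOf F (convexHull ℝ (range v))}.Finite := by
  refine (finite_range fun Z : Set ι => convexHull ℝ (v '' Z)).subset ?_
  rintro F ⟨hF, -⟩
  obtain ⟨w, -, -, -, h⟩ := hF.exists_nonneg
  exact ⟨_, h.symm⟩

theorem vertexSet_convexHull_range_subset [Fintype ι] (v : ι → Fin N → ℝ) :
    vertexSet (convexHull ℝ (range v)) ⊆ range v := by
  intro x hx
  obtain ⟨w, -, -, -, h⟩ := IsFaceOf.exists_nonneg (show IsFaceOf {x} _ from hx)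
  have hne : (v '' {i | w i = 0}).Nonempty := by
    rw [← convexHull_nonempty_iff (𝕜 := ℝ), ← h]; exact singleton_nonempty x
  obtain ⟨y, hy⟩ := hne
  have : y ∈ ({x} : Set (Fin N → ℝ)) := by rw [h]; exact subset_convexHull ℝ _ hy
  rw [← mem_singleton_iff.1 this]
  exact image_subset_range _ _ hy

theorem pdim_convexHull_range [Fintype ι] (v : ι → Fin N → ℝ) :
    pdim (convexHull ℝ (range v)) + 1 = Module.finrank ℝ (affEval v) := by
  classical
  rcases isEmpty_or_nonempty ι with hι | ⟨⟨i0⟩⟩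
  · have : Module.finrank ℝ (affEval v) = 0 := Module.finrank_zero_of_subsingleton
    rw [this]
    simp [pdim, range_eq_empty]
  · have hne : (convexHull ℝ (range v)).Nonempty :=
      ⟨v i0, subset_convexHull ℝ _ (mem_range_self i0)⟩
    set M : Matrix ι (Fin N) ℝ := Matrix.of fun i k => v i k - v i0 k with hM
    have h1 : Module.finrank ℝ (affineSpan ℝ (convexHull ℝ (range v))).direction = M.rank := by
      rw [affineSpan_convexHull, direction_affineSpan,
        vectorSpan_range_eq_span_range_vsub_right ℝ v i0, Matrix.rank_eq_finrank_span_row]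
      rfl
    have h2 : affEval v = LinearMap.range M.mulVecLin ⊔ Submodule.span ℝ {(1 : ι → ℝ)} := by
      apply le_antisymm
      · intro w hw
        obtain ⟨c, b, h⟩ := mem_affEval.1 hw
        have : w = M.mulVecLin c + (∑ k, c k * v i0 k + b) • (1 : ι → ℝ) := by
          ext i
          rw [← h i]
          simp only [hM, Matrix.mulVecLin_apply, Matrix.mulVec, dotProduct, Matrix.of_apply,
            Pi.add_apply, Pi.smul_apply, Pi.one_apply, smul_eq_mul, sub_mul,
            Finset.sum_sub_distrib]
          simp only [mul_comm (c _)]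
          ring
        rw [this]
        exact Submodule.add_mem_sup (LinearMap.mem_range_self _ _)
          (Submodule.smul_mem _ _ (Submodule.mem_span_singleton_self _))
      · refine sup_le ?_ ?_
        · rintro _ ⟨c, rfl⟩
          refine mem_affEval.2 ⟨c, -∑ k, c k * v i0 k, fun i => ?_⟩
          simp only [hM, Matrix.mulVecLin_apply, Matrix.mulVec, dotProduct, Matrix.of_apply,
            sub_mul, Finset.sum_sub_distrib]
          simp only [mul_comm (c _)]
          ring
        · rw [Submodule.span_singleton_le_iff_mem]
          exact one_mem_affEval v
    have h3 : LinearMap.range M.mulVecLin ⊓ Submodule.span ℝ {(1 : ι → ℝ)} = ⊥ := by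
      rw [Submodule.eq_bot_iff]
      rintro w ⟨⟨c, hc⟩, hw⟩
      obtain ⟨a, rfl⟩ := Submodule.mem_span_singleton.1 hw
      have := congrFun hc i0
      simp [hM, Matrix.mulVec, dotProduct] at this
      simp [← this]
    have h4 := Submodule.finrank_sup_add_finrank_inf_eq (LinearMap.range M.mulVecLin)
      (Submodule.span ℝ {(1 : ι → ℝ)})
    rw [h3, ← h2, finrank_bot, finrank_span_singleton (fun h => by
      simpa using congrFun h i0)] at h4
    have h5 : pdim (convexHull ℝ (range v)) = (M.rank : ℤ) := by
      rw [pdim, if_pos hne, h1]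
    rw [h5, Matrix.rank]
    omega

theorem finrank_affEval_restrict [Fintype ι] (v : ι → Fin N → ℝ) (Z : Set ι) {w : ι → ℝ}
    (hw : w ∈ affEval v) (hw0 : w ≠ 0) (hZ : ∀ i ∈ Z, w i = 0)
    (h : ∀ u ∈ affEval v, (∀ i ∈ Z, u i = 0) → ∃ s : ℝ, u = s • w) :
    Module.finrank ℝ (affEval fun i : Z => v i) + 1 = Module.finrank ℝ (affEval v) := by
  let ρ : affEval v →ₗ[ℝ] (Z → ℝ) := (LinearMap.funLeft ℝ ℝ (Subtype.val : Z → ι)).comp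
    (affEval v).subtype
  have hρ : ∀ u i, ρ u i = u.1 i := fun _ _ => rfl
  have hr : LinearMap.range ρ = affEval fun i : Z => v i := by
    ext u
    constructor
    · rintro ⟨⟨u, hu⟩, rfl⟩
      obtain ⟨c, b, h⟩ := mem_affEval.1 hu
      exact mem_affEval.2 ⟨c, b, fun i => h i⟩
    · intro hu
      obtain ⟨c, b, h⟩ := mem_affEval.1 hu
      exact ⟨⟨fun i => ∑ k, c k * v i k + b, mem_affEval.2 ⟨c, b, fun i => rfl⟩⟩, funext h⟩
  have hk : LinearMap.ker ρ = Submodule.span ℝ {⟨w, hw⟩} := by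
    ext u
    rw [LinearMap.mem_ker, Submodule.mem_span_singleton]
    constructor
    · intro hu
      obtain ⟨s, hs⟩ := h u.1 u.2 fun i hi => congrFun hu ⟨i, hi⟩
      exact ⟨s, Subtype.ext hs.symm⟩
    · rintro ⟨s, rfl⟩
      ext i
      simp [hρ, hZ i.1 i.2]
  have := LinearMap.finrank_range_add_finrank_ker ρ
  rwa [hr, hk, finrank_span_singleton (fun h => hw0 (congrArg Subtype.val h))] at this

theorem image_eq_range_restrict {E : Type*} (v : ι → E) (Z : Set ι) :
    v '' Z = range fun i : Z => v i := by
  rw [image_eq_range]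

end Evaluation

section Facets

variable {N : ℕ}

theorem sum_eq_on_affineSpan {S : Set (Fin N → ℝ)} {c : Fin N → ℝ} {b : ℝ}
    (h : ∀ x ∈ S, ∑ k, c k * x k = b) : ∀ x ∈ affineSpan ℝ S, ∑ k, c k * x k = b := by
  let L : (Fin N → ℝ) →ₗ[ℝ] ℝ := ∑ k, c k • LinearMap.proj k
  have hL : ∀ x, L x = ∑ k, c k * x k := fun x => by simp [L]
  have : affineSpan ℝ S ≤ (affineSpan ℝ {b}).comap L.toAffineMap := by
    rw [affineSpan_le]
    intro x hx
    simp [hL, h x hx]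
  intro x hx
  have := this hx
  simpa [hL] using this

theorem IsFaceOf.subset {F P : Set (Fin N → ℝ)} (h : IsFaceOf F P) : F ⊆ P := by
  obtain ⟨c, b, -, rfl⟩ := h
  exact sep_subset _ _

theorem isFaceOf_self (P : Set (Fin N → ℝ)) : IsFaceOf P P :=
  ⟨0, 0, fun x _ => by simp, by simp⟩

theorem IsFacetOf.ne {F P : Set (Fin N → ℝ)} (h : IsFacetOf F P) : F ≠ P := by
  rintro rfl
  have := h.2
  omega

theorem IsFacetOf.eq_of_subset {F G P : Set (Fin N → ℝ)} (hF : IsFacetOf F P)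
    (hG : IsFaceOf G P) (hne : G ≠ P) (hFG : F ⊆ G) : F = G := by
  obtain ⟨hFf, hdim⟩ := hF
  have hGP := hG.subset
  obtain ⟨c, b, hle, hGe⟩ := hG
  obtain ⟨x, hxP, hxb⟩ : ∃ x ∈ P, ∑ k, c k * x k ≠ b := by
    by_contra! hcon
    exact hne (hGe.trans (Set.sep_eq_self_iff_mem_true.2 hcon))
  have hPne : P.Nonempty := ⟨x, hxP⟩
  have hG_eq : ∀ y ∈ affineSpan ℝ G, ∑ k, c k * y k = b :=
    sum_eq_on_affineSpan fun y hy => by rw [hGe] at hy; exact hy.2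
  rcases F.eq_empty_or_nonempty with rfl | hFne
  · simp only [pdim, if_pos hPne, if_neg Set.not_nonempty_empty] at hdim
    have h0 : Module.finrank ℝ (affineSpan ℝ P).direction = 0 := by omega
    rw [Submodule.finrank_eq_zero] at h0
    by_contra hcon
    obtain ⟨y, hy⟩ := nonempty_iff_ne_empty.2 (Ne.symm hcon)
    have h1 : x -ᵥ y ∈ (affineSpan ℝ P).direction :=
      AffineSubspace.vsub_mem_direction (subset_affineSpan ℝ P hxP)
        (subset_affineSpan ℝ P (hGP hy))
    rw [h0, Submodule.mem_bot, vsub_eq_zero_iff_eq] at h1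
    exact hxb (h1 ▸ hG_eq y (subset_affineSpan ℝ G hy))
  · have hGne : G.Nonempty := hFne.mono hFG
    simp only [pdim, if_pos hPne, if_pos hFne] at hdim
    have h1 : (affineSpan ℝ F).direction ≤ (affineSpan ℝ G).direction :=
      AffineSubspace.direction_le (affineSpan_mono ℝ hFG)
    have h2 : (affineSpan ℝ G).direction < (affineSpan ℝ P).direction := by
      refine lt_of_le_of_ne (AffineSubspace.direction_le (affineSpan_mono ℝ hGP)) fun h => hxb ?_
      have h3 : affineSpan ℝ G = affineSpan ℝ P :=
        AffineSubspace.eq_of_direction_eq_of_nonempty_of_le h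
          ((affineSpan_nonempty ℝ).2 hGne) (affineSpan_mono ℝ hGP)
      exact hG_eq x (h3 ▸ subset_affineSpan ℝ P hxP)
    have h4 := Submodule.finrank_lt_finrank_of_lt h2
    have h5 := Submodule.finrank_mono h1
    have h6 : (affineSpan ℝ F).direction = (affineSpan ℝ G).direction :=
      Submodule.eq_of_le_of_finrank_eq h1 (by omega)
    have h7 : affineSpan ℝ F = affineSpan ℝ G :=
      AffineSubspace.eq_of_direction_eq_of_nonempty_of_le h6
        ((affineSpan_nonempty ℝ).2 hFne) (affineSpan_mono ℝ hFG)
    obtain ⟨c', b', -, hFe⟩ := hFf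
    refine Subset.antisymm hFG fun y hy => ?_
    have h8 : ∀ z ∈ affineSpan ℝ F, ∑ k, c' k * z k = b' :=
      sum_eq_on_affineSpan fun z hz => by rw [hFe] at hz; exact hz.2
    rw [hFe]
    exact ⟨hGP hy, h8 y (h7 ▸ subset_affineSpan ℝ G hy)⟩

theorem CombEquiv.refl (P : Set (Fin N → ℝ)) : CombEquiv P P :=
  ⟨Equiv.refl _, fun _ _ => Iff.rfl⟩

/-- If every proper face of the model `convexHull ℝ (range t)` lies in one of the proper faces
cut out by the functionals `u b`, then there are at most as many facets as functionals. -/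
theorem facetCount_le_of_combEquiv {M : ℕ} {ι β : Type*} [Fintype ι] [Fintype β]
    {P : Set (Fin N → ℝ)} (t : ι → Fin M → ℝ) (hP : CombEquiv P (convexHull ℝ (range t)))
    (u : β → ι → ℝ) (hu : ∀ b, u b ∈ affEval t) (hu0 : ∀ b i, 0 ≤ u b i) (hune : ∀ b, u b ≠ 0)
    (hmax : ∀ w ∈ affEval t, (∀ i, 0 ≤ w i) → w ≠ 0 → ∃ b, ∀ i, w i = 0 → u b i = 0) :
    facetCount P ≤ Fintype.card β := by
  set T := convexHull ℝ (range t) with hT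
  obtain ⟨φ, hφ⟩ := hP
  have hφs : ∀ G₁ G₂, G₁.1 ⊆ G₂.1 ↔ (φ.symm G₁).1 ⊆ (φ.symm G₂).1 := by
    intro G₁ G₂
    rw [hφ, φ.apply_symm_apply, φ.apply_symm_apply]
  have htop : ∀ F : {F // IsFaceOf F P}, (φ F).1 = T → F.1 = P := by
    intro F hF
    refine Subset.antisymm F.2.subset ?_
    have : (⟨P, isFaceOf_self P⟩ : {F // IsFaceOf F P}).1 ⊆ F.1 := by
      rw [hφ, hF]
      exact (φ _).2.subset
    exact this
  have htop' : ∀ G : {G // IsFaceOf G T}, (φ.symm G).1 = P → G.1 = T := by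
    intro G hG
    refine Subset.antisymm G.2.subset ?_
    have : (⟨T, isFaceOf_self T⟩ : {F // IsFaceOf F T}).1 ⊆ G.1 := by
      rw [hφs, hG]
      exact (φ.symm _).2.subset
    exact this
  let S : β → {G // IsFaceOf G T} := fun b => ⟨_, (isFaceOf_of_nonneg (hu b) (hu0 b)).1⟩
  have hsub : {F | IsFacetOf F P} ⊆ range fun b => (φ.symm (S b)).1 := by
    intro F (hF : IsFacetOf F P)
    obtain ⟨w, hw, hw0, hwi, hwG⟩ := (φ ⟨F, hF.1⟩).2.exists_nonneg
    have hwne : w ≠ 0 := by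
      rintro rfl
      refine hF.ne (htop ⟨F, hF.1⟩ ?_)
      rw [hwG]
      simp [hT]
    obtain ⟨b, hb⟩ := hmax w hw hw0 hwne
    refine ⟨b, ?_⟩
    symm
    refine hF.eq_of_subset (φ.symm (S b)).2 ?_ ?_
    · intro h
      have h1 := htop' _ h
      apply hune b
      ext i
      have h2 := (isFaceOf_of_nonneg (hu b) (hu0 b)).2
      have h3 : t i ∈ (S b).1 := by rw [h1]; exact subset_convexHull ℝ _ (mem_range_self i)
      have h4 : i ∈ {i | u b i = 0} := h2 ▸ h3
      exact h4
    · have : (⟨F, hF.1⟩ : {F // IsFaceOf F P}).1 ⊆ (φ.symm (S b)).1 := by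
        rw [hφ, φ.apply_symm_apply, hwG]
        exact convexHull_mono (image_mono hb)
      exact this
  calc facetCount P ≤ (range fun b => (φ.symm (S b)).1).ncard :=
        ncard_le_ncard hsub (finite_range _)
    _ ≤ Fintype.card β := by
        rw [← image_univ, ← Nat.card_eq_fintype_card, ← ncard_univ]
        exact ncard_image_le finite_univ

/-- Point families whose affine value spaces agree up to a positive diagonal scaling span
combinatorially equivalent polytopes. -/
theorem combEquiv_of_scaling {M : ℕ} {ι : Type*} [Fintype ι] (s : ι → Fin N → ℝ)
    (t : ι → Fin M → ℝ) (r : ι → ℝ) (hr : ∀ i, 0 < r i)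
    (h1 : ∀ w ∈ affEval s, (fun i => r i * w i) ∈ affEval t)
    (h2 : ∀ w ∈ affEval t, (fun i => (r i)⁻¹ * w i) ∈ affEval s) :
    CombEquiv (convexHull ℝ (range s)) (convexHull ℝ (range t)) := by
  have hst : ∀ Z, IsZeroSet (affEval s) Z → IsZeroSet (affEval t) Z := by
    rintro _ ⟨w, hw, hw0, rfl⟩
    refine ⟨_, h1 w hw, fun i => mul_nonneg (hr i).le (hw0 i), ?_⟩
    ext i
    simp [(hr i).ne']
  have hts : ∀ Z, IsZeroSet (affEval t) Z → IsZeroSet (affEval s) Z := by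
    rintro _ ⟨w, hw, hw0, rfl⟩
    refine ⟨_, h2 w hw, fun i => mul_nonneg (inv_pos.2 (hr i)).le (hw0 i), ?_⟩
    ext i
    simp [(hr i).ne']
  have toFace : ∀ {K : ℕ} (v : ι → Fin K → ℝ) (Z), IsZeroSet (affEval v) Z →
      IsFaceOf (convexHull ℝ (v '' Z)) (convexHull ℝ (range v)) ∧
        {i | v i ∈ convexHull ℝ (v '' Z)} = Z := by
    rintro K v _ ⟨w, hw, hw0, rfl⟩
    exact isFaceOf_of_nonneg hw hw0
  have ofFace : ∀ {K : ℕ} (v : ι → Fin K → ℝ) (F), IsFaceOf F (convexHull ℝ (range v)) →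
      IsZeroSet (affEval v) {i | v i ∈ F} ∧ F = convexHull ℝ (v '' {i | v i ∈ F}) := by
    intro K v F hF
    obtain ⟨w, hw, hw0, hwi, hwF⟩ := hF.exists_nonneg
    exact ⟨⟨w, hw, hw0, hwi⟩, by rw [hwi]; exact hwF⟩
  refine ⟨⟨fun F => ⟨convexHull ℝ (t '' {i | s i ∈ F.1}),
      (toFace t _ (hst _ (ofFace s F.1 F.2).1)).1⟩,
    fun G => ⟨convexHull ℝ (s '' {i | t i ∈ G.1}),
      (toFace s _ (hts _ (ofFace t G.1 G.2).1)).1⟩, ?_, ?_⟩, ?_⟩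
  · rintro ⟨F, hF⟩
    apply Subtype.ext
    dsimp only
    rw [(toFace t _ (hst _ (ofFace s F hF).1)).2]
    exact (ofFace s F hF).2.symm
  · rintro ⟨G, hG⟩
    apply Subtype.ext
    dsimp only
    rw [(toFace s _ (hts _ (ofFace t G hG).1)).2]
    exact (ofFace t G hG).2.symm
  · rintro ⟨F, hF⟩ ⟨G, hG⟩
    dsimp only [Equiv.coe_fn_mk]
    constructor
    · intro h
      exact convexHull_mono (image_mono fun i hi => h hi)
    · intro h
      have h3 : {i | s i ∈ F} ⊆ {i | s i ∈ G} := by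
        rw [← (toFace t _ (hst _ (ofFace s F hF).1)).2, ← (toFace t _ (hst _ (ofFace s G hG).1)).2]
        exact fun i hi => h hi
      rw [(ofFace s F hF).2, (ofFace s G hG).2]
      exact convexHull_mono (image_mono h3)

end Facets

section Cone

theorem exists_pos_mul_abs_le {ι : Type*} [Fintype ι] (a b : ι → ℝ) (ha : ∀ i, 0 ≤ a i)
    (hab : ∀ i, a i = 0 → b i = 0) : ∃ ε > 0, ∀ i, ε * |b i| ≤ a i := by
  have hs : ∀ i, 0 ≤ |b i| / a i := fun i => div_nonneg (abs_nonneg _) (ha i)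
  have hS : 0 ≤ ∑ i, |b i| / a i := Finset.sum_nonneg fun i _ => hs i
  refine ⟨(1 + ∑ i, |b i| / a i)⁻¹, by positivity, fun i => ?_⟩
  rcases (ha i).eq_or_lt with h | h
  · simp [hab i h.symm, ← h]
  · rw [inv_mul_le_iff₀ (by positivity)]
    have h1 : |b i| / a i ≤ 1 + ∑ i, |b i| / a i := by
      have := Finset.single_le_sum (f := fun i => |b i| / a i) (fun i _ => hs i) (Finset.mem_univ i)
      linarith
    rwa [div_le_iff₀ h] at h1

/-- The nonnegative cone of a subspace is generated by its extreme rays. -/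
theorem nonneg_generated_of_extreme {ι α : Type*} [Fintype ι] [Fintype α]
    (W : Submodule ℝ (ι → ℝ)) (g : α → ι → ℝ) (hg0 : ∀ a i, 0 ≤ g a i)
    (hext : ∀ w ∈ W, (∀ i, 0 ≤ w i) → w ≠ 0 →
      (∀ u ∈ W, (∀ i, w i = 0 → u i = 0) → ∃ s : ℝ, u = s • w) →
      ∃ (a : α) (s : ℝ), w = s • g a)
    (w : ι → ℝ) (hw : w ∈ W) (hw0 : ∀ i, 0 ≤ w i) :
    ∃ l : α → ℝ, (∀ a, 0 ≤ l a) ∧ w = ∑ a, l a • g a := by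
  classical
  set K : Set (ι → ℝ) := (W : Set (ι → ℝ)) ∩ stdSimplex ℝ ι with hK
  have hKc : IsCompact K := (isCompact_stdSimplex ℝ ι).inter_left
    (Submodule.closed_of_finiteDimensional W)
  have hKconv : Convex ℝ K := W.convex.inter (convex_stdSimplex ℝ ι)
  have hE : K.extremePoints ℝ ⊆ range fun a => (∑ i, g a i)⁻¹ • g a := by
    intro x hx
    obtain ⟨⟨hxW, hx0, hx1⟩, hxe⟩ := mem_extremePoints.1 hx
    have hxne : x ≠ 0 := by
      rintro rfl
      simp at hx1
    obtain ⟨a, s, has⟩ := hext x hxW hx0 hxne (by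
      intro u hu hux
      set s := ∑ i, u i with hs
      set u' := u - s • x with hu'
      have hu'W : u' ∈ W := W.sub_mem hu (W.smul_mem _ hxW)
      have hu's : ∑ i, u' i = 0 := by
        simp [hu', Finset.sum_sub_distrib, ← Finset.mul_sum, hx1, hs]
      have hu'x : ∀ i, x i = 0 → u' i = 0 := by
        intro i hi
        simp [hu', hux i hi, hi]
      obtain ⟨ε, hε, hle⟩ := exists_pos_mul_abs_le x u' hx0 hu'x
      have hm : ∀ δ : ℝ, |δ| ≤ ε → x + δ • u' ∈ K := by
        intro δ hδ
        refine ⟨W.add_mem hxW (W.smul_mem _ hu'W), fun i => ?_, ?_⟩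
        · have h1 := hle i
          have h2 : |δ * u' i| ≤ ε * |u' i| := by
            rw [abs_mul]
            exact mul_le_mul_of_nonneg_right hδ (abs_nonneg _)
          have h3 := neg_abs_le (δ * u' i)
          simp only [Pi.add_apply, Pi.smul_apply, smul_eq_mul]
          linarith
        · simp [Finset.sum_add_distrib, ← Finset.mul_sum, hx1, hu's]
      have h4 := hxe _ (hm ε (abs_of_pos hε).le) _ (hm (-ε) (by rw [abs_neg, abs_of_pos hε]))
        ⟨1 / 2, 1 / 2, by norm_num, by norm_num, by norm_num, by
          ext i
          simp only [Pi.add_apply, Pi.smul_apply, smul_eq_mul]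
          ring⟩
      have h5 : ε • u' = 0 := by simpa using h4.1
      have h6 : u' = 0 := (smul_eq_zero.1 h5).resolve_left hε.ne'
      exact ⟨s, sub_eq_zero.1 h6⟩)
    refine ⟨a, ?_⟩
    have h1 : s * ∑ i, g a i = 1 := by
      rw [← hx1, has]
      simp [Finset.mul_sum]
    dsimp only
    rw [has, ← eq_inv_of_mul_eq_one_left h1]
  have hKsub : K ⊆ convexHull ℝ (range fun a => (∑ i, g a i)⁻¹ • g a) := by
    rw [← closure_convexHull_extremePoints hKc hKconv]
    exact closure_minimal (convexHull_mono hE) (((finite_range _).isCompact_convexHull ℝ).isClosed)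
  by_cases hwz : w = 0
  · exact ⟨0, fun _ => le_rfl, by simp [hwz]⟩
  have hpos : 0 < ∑ i, w i := by
    refine lt_of_le_of_ne (Finset.sum_nonneg fun i _ => hw0 i) fun h => hwz ?_
    ext i
    exact (Finset.sum_eq_zero_iff_of_nonneg fun i _ => hw0 i).1 h.symm i (Finset.mem_univ i)
  have hwK : (∑ i, w i)⁻¹ • w ∈ K := by
    refine ⟨W.smul_mem _ hw, fun i => ?_, ?_⟩
    · exact mul_nonneg (inv_pos.2 hpos).le (hw0 i)
    · simp [← Finset.mul_sum, hpos.ne']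
  obtain ⟨l, hl0, -, hl⟩ := (mem_convexHull_range_iff _ _).1 (hKsub hwK)
  refine ⟨fun a => (∑ i, w i) * (l a * (∑ i, g a i)⁻¹), fun a => ?_, ?_⟩
  · have := hl0 a
    have : 0 ≤ ∑ i, g a i := Finset.sum_nonneg fun i _ => hg0 a i
    positivity
  · have h1 : w = (∑ i, w i) • ((∑ i, w i)⁻¹ • w) := by
      rw [smul_smul, mul_inv_cancel₀ hpos.ne', one_smul]
    rw [← hl, Finset.smul_sum] at h1
    simpa only [mul_smul] using h1

/-- The facet functionals generate all nonnegative affine functionals. -/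
theorem exists_facet_generators {ι : Type*} [Fintype ι] {e : ℕ} (q : ι → Fin e → ℝ) :
    ∃ g : Fin (facetCount (convexHull ℝ (range q))) → ι → ℝ,
      (∀ a, g a ∈ affEval q) ∧ (∀ a i, 0 ≤ g a i) ∧
      ∀ w ∈ affEval q, (∀ i, 0 ≤ w i) →
        ∃ l : Fin (facetCount (convexHull ℝ (range q))) → ℝ,
          (∀ a, 0 ≤ l a) ∧ w = ∑ a, l a • g a := by
  classical
  set Q := convexHull ℝ (range q) with hQ
  have : Finite {F | IsFacetOf F Q} := finite_isFacetOf q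
  let σ : {F | IsFacetOf F Q} ≃ Fin (facetCount Q) := Finite.equivFinOfCardEq rfl
  have hex : ∀ F : {F | IsFacetOf F Q}, ∃ w ∈ affEval q, (∀ i, 0 ≤ w i) ∧
      {i | q i ∈ F.1} = {i | w i = 0} ∧ F.1 = convexHull ℝ (q '' {i | w i = 0}) :=
    fun F => F.2.1.exists_nonneg
  choose g hgW hg0 hgi hgF using hex
  refine ⟨fun a => g (σ.symm a), fun a => hgW _, fun a => hg0 _, fun w hw hw0 => ?_⟩
  refine nonneg_generated_of_extreme (affEval q) _ (fun a => hg0 _) ?_ w hw hw0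
  intro w hw hw0 hwne hext
  have hface := isFaceOf_of_nonneg hw hw0
  have hfacet : IsFacetOf (convexHull ℝ (q '' {i | w i = 0})) Q := by
    refine ⟨hface.1, ?_⟩
    have h1 := finrank_affEval_restrict q {i | w i = 0} hw hwne (fun i hi => hi) hext
    have h2 : pdim Q + 1 = _ := pdim_convexHull_range q
    have h3 := pdim_convexHull_range fun i : {i | w i = 0} => q i
    rw [image_eq_range_restrict]
    omega
  set F : {F | IsFacetOf F Q} := ⟨_, hfacet⟩ with hF
  have hz : {i | g F i = 0} = {i | w i = 0} := by
    rw [← hgi F, ← hface.2]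
  refine ⟨σ F, ?_⟩
  rw [σ.symm_apply_apply]
  obtain ⟨s, hs⟩ := hext (g F) (hgW F) fun i hi => by
    have : i ∈ {i | g F i = 0} := hz ▸ hi
    exact this
  have hs0 : s ≠ 0 := by
    rintro rfl
    apply hwne
    ext i
    have : i ∈ {i | w i = 0} := hz ▸ (show g F i = 0 by rw [hs]; simp)
    exact this
  exact ⟨s⁻¹, by rw [hs, smul_smul, inv_mul_cancel₀ hs0, one_smul]⟩

end Cone

section Models

theorem exists_vertex_enumeration {N n : ℕ} {P : Set (Fin N → ℝ)} (hP : IsPolytope P)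
    (hn : vertexCount P = n) :
    ∃ v : Fin n → Fin N → ℝ, P = convexHull ℝ (range v) ∧ ∀ i, IsVertexOf (v i) P := by
  classical
  have hex : ∃ m, ∃ S : Finset (Fin N → ℝ), S.card = m ∧ P = convexHull ℝ (S : Set _) := by
    obtain ⟨S, hS⟩ := hP
    exact ⟨_, S, rfl, hS⟩
  obtain ⟨S, hSc, hS⟩ := Nat.find_spec hex
  have hrange : range (Subtype.val : S → Fin N → ℝ) = (S : Set _) := Subtype.range_coe
  have hvert : ∀ x ∈ S, IsVertexOf x P := by
    intro x hx
    have hnot : x ∉ convexHull ℝ ((S.erase x : Finset _) : Set (Fin N → ℝ)) := by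
      intro hmem
      have h1 : P = convexHull ℝ ((S.erase x : Finset _) : Set (Fin N → ℝ)) := by
        rw [hS]
        refine Subset.antisymm (convexHull_min (fun y hy => ?_) (convex_convexHull ℝ _))
          (convexHull_mono (Finset.coe_subset.2 (Finset.erase_subset _ _)))
        by_cases hyx : y = x
        · exact hyx ▸ hmem
        · exact subset_convexHull ℝ _ (Finset.mem_coe.2 (Finset.mem_erase.2 ⟨hyx, hy⟩))
      have h2 := Nat.find_min' hex ⟨S.erase x, rfl, h1⟩
      have h3 := Finset.card_erase_lt_of_mem hx
      omega
    obtain ⟨f, u, hfx, hfu⟩ := geometric_hahn_banach_point_closed (convex_convexHull ℝ _)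
      ((Finset.finite_toSet _).isCompact_convexHull ℝ).isClosed hnot
    have hf : ∀ y, f y = ∑ k, f (Pi.single k 1) * y k := by
      intro y
      have := (f : (Fin N → ℝ) →ₗ[ℝ] ℝ).pi_apply_eq_sum_univ y
      rw [ContinuousLinearMap.coe_coe] at this
      rw [this]
      refine Finset.sum_congr rfl fun k _ => ?_
      rw [smul_eq_mul, mul_comm]
      congr 2
      ext j
      simp [Pi.single_apply, eq_comm]
    have hneg : ∀ y : Fin N → ℝ, ∑ k, -f (Pi.single k 1) * y k = -f y := by
      intro y
      rw [hf y]
      simp only [neg_mul, Finset.sum_neg_distrib]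
    have hlt : ∀ y ∈ S, y ≠ x → f x < f y := fun y hy hyx =>
      hfx.trans (hfu y (subset_convexHull ℝ _ (Finset.mem_coe.2 (Finset.mem_erase.2 ⟨hyx, hy⟩))))
    have hle : ∀ i : S, ∑ k, -f (Pi.single k 1) * (i : Fin N → ℝ) k ≤ -f x := by
      rintro ⟨y, hy⟩
      rw [hneg]
      by_cases hyx : y = x
      · subst hyx; exact le_rfl
      · exact neg_le_neg (hlt y hy hyx).le
    have hsep := convexHull_range_sep_eq (Subtype.val : S → Fin N → ℝ) _ _ hle
    have himg : (Subtype.val : S → Fin N → ℝ) ''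
        {i | ∑ k, -f (Pi.single k 1) * (i : Fin N → ℝ) k = -f x} = {x} := by
      ext y
      simp only [mem_image, mem_ofPred_eq, hneg, mem_singleton_iff, neg_inj]
      constructor
      · rintro ⟨⟨z, hz⟩, hzx, rfl⟩
        by_contra hne
        exact (hlt z hz hne).ne hzx.symm
      · rintro rfl
        exact ⟨⟨y, hx⟩, rfl, rfl⟩
    rw [himg, convexHull_singleton] at hsep
    refine ⟨fun k => -f (Pi.single k 1), -f x, ?_, ?_⟩
    · rw [hS, ← hrange]
      exact le_on_convexHull_range _ _ _ hle
    · rw [← hsep, hrange, ← hS]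
  have hVS : vertexSet P = (S : Set _) := by
    refine Subset.antisymm ?_ hvert
    rw [hS, ← hrange]
    exact vertexSet_convexHull_range_subset _
  have hcard : Fintype.card S = n := by
    rw [← hn, vertexCount, hVS, ncard_coe_finset, Fintype.card_coe]
  let σ := Fintype.equivFinOfCardEq hcard
  refine ⟨fun i => (σ.symm i).1, ?_, fun i => hvert _ (σ.symm i).2⟩
  rw [hS, ← hrange]
  congr 1
  exact (σ.symm.surjective.range_comp Subtype.val).symm

theorem exists_linearMap_apply_single {N m : ℕ} (v : Fin m → Fin N → ℝ) :
    ∃ T : (Fin m → ℝ) →ₗ[ℝ] (Fin N → ℝ), ∀ i, T (Pi.single i 1) = v i :=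
  ⟨Fintype.linearCombination ℝ v, fun i => by simp⟩

theorem facetCount_convexHull_single_le (m : ℕ) :
    facetCount (convexHull ℝ (range fun i : Fin m => (Pi.single i 1 : Fin m → ℝ))) ≤ m := by
  classical
  have hall : ∀ w : Fin m → ℝ,
      w ∈ affEval fun i : Fin m => (Pi.single i 1 : Fin m → ℝ) := fun w =>
    mem_affEval.2 ⟨w, 0, fun i => by simp [Pi.single_apply]⟩
  have := facetCount_le_of_combEquiv _ (CombEquiv.refl _)
    (fun b : Fin m => (Pi.single b 1 : Fin m → ℝ)) (fun b => hall _)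
    (fun b i => by by_cases h : i = b <;> simp [h])
    (fun b h => by simpa using congrFun h b)
    (fun w _ _ hne => by
      obtain ⟨b, hb⟩ := Function.ne_iff.1 hne
      refine ⟨b, fun i hi => ?_⟩
      have : i ≠ b := by rintro rfl; exact hb hi
      simp [this])
  simpa using this

/-- Vertices of `simplexF 1`. -/
def segVert : Fin 2 → Fin 1 → ℝ := ![Pi.single 0 1, fun _ => -1]

/-- Vertices of `simplexF 2`. -/
def triVert : Fin 3 → Fin 2 → ℝ := ![Pi.single 0 1, Pi.single 1 1, fun _ => -1]

/-- Vertices of the `k`-fold pyramid over the triangular prism. -/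
def pyrPrismVert (k : ℕ) : Fin k ⊕ Fin 2 × Fin 3 → Fin (1 + 2 + k) → ℝ
  | .inl j => Fin.append (0 : Fin (1 + 2) → ℝ) (Pi.single j 1)
  | .inr p => Fin.append (Fin.append (segVert p.1) (triVert p.2)) (0 : Fin k → ℝ)

theorem simplexF_one : simplexF 1 = convexHull ℝ (range segVert) := by
  unfold simplexF
  congr 1
  ext x
  simp [segVert, eq_comm]

theorem simplexF_two : simplexF 2 = convexHull ℝ (range triVert) := by
  unfold simplexF
  congr 1
  ext x
  simp [triVert, Fin.exists_fin_succ, eq_comm]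
  tauto

theorem isLinearMap_append (m n : ℕ) :
    IsLinearMap ℝ fun z : (Fin m → ℝ) × (Fin n → ℝ) => Fin.append z.1 z.2 := by
  constructor
  · intro x y
    ext i
    refine Fin.addCases (fun i => ?_) (fun i => ?_) i <;> simp
  · intro r x
    ext i
    refine Fin.addCases (fun i => ?_) (fun i => ?_) i <;> simp

theorem isLinearMap_append_zero (m n : ℕ) :
    IsLinearMap ℝ fun z : Fin m → ℝ => Fin.append z (0 : Fin n → ℝ) := by
  constructor
  · intro x y
    ext i
    refine Fin.addCases (fun i => ?_) (fun i => ?_) i <;> simp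
  · intro r x
    ext i
    refine Fin.addCases (fun i => ?_) (fun i => ?_) i <;> simp

theorem prodP_one_two :
    prodP 1 2 = convexHull ℝ (range fun p : Fin 2 × Fin 3 =>
      Fin.append (segVert p.1) (triVert p.2)) := by
  have h1 : prodP 1 2 = (fun z : (Fin 1 → ℝ) × (Fin 2 → ℝ) => Fin.append z.1 z.2) ''
      (simplexF 1 ×ˢ simplexF 2) := by
    ext z
    constructor
    · rintro ⟨a, ha, b, hb, rfl⟩
      exact ⟨(a, b), ⟨ha, hb⟩, rfl⟩
    · rintro ⟨⟨a, b⟩, ⟨ha, hb⟩, rfl⟩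
      exact ⟨a, ha, b, hb, rfl⟩
  rw [h1, simplexF_one, simplexF_two, ← convexHull_prod, (isLinearMap_append 1 2).image_convexHull,
    ← range_prodMap, ← range_comp]
  rfl

theorem pyrK_prism (k : ℕ) : pyrK k (prodP 1 2) = convexHull ℝ (range (pyrPrismVert k)) := by
  unfold pyrK
  rw [prodP_one_two, (isLinearMap_append_zero (1 + 2) k).image_convexHull,
    convexHull_convexHull_union_left, ← range_comp, union_comm, Sum.range_eq]
  rfl

theorem mem_affEval_pyrPrismVert {k : ℕ} {w : Fin k ⊕ Fin 2 × Fin 3 → ℝ} :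
    w ∈ affEval (pyrPrismVert k) ↔ ∃ (x : Fin k → ℝ) (y : Fin 2 → ℝ) (z : Fin 3 → ℝ),
      (∀ j, w (.inl j) = x j) ∧ ∀ i j, w (.inr (i, j)) = y i + z j := by
  classical
  rw [mem_affEval]
  constructor
  · rintro ⟨c, b, h⟩
    refine ⟨fun j => w (.inl j), fun i => ∑ t, c (Fin.castAdd k (Fin.castAdd 2 t)) * segVert i t,
      fun j => ∑ t, c (Fin.castAdd k (Fin.natAdd 1 t)) * triVert j t + b, fun _ => rfl,
      fun i j => ?_⟩
    rw [← h, Fin.sum_univ_add]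
    simp only [pyrPrismVert, Fin.append_left, Fin.append_right, Pi.zero_apply, mul_zero,
      Finset.sum_const_zero, add_zero]
    rw [Fin.sum_univ_add]
    simp only [Fin.append_left, Fin.append_right]
    ring
  · rintro ⟨x, y, z, hx, hyz⟩
    set b := (y 0 + y 1) / 2 + (z 0 + z 1 + z 2) / 3 with hb
    set c1 : Fin 1 → ℝ := fun _ => (y 0 - y 1) / 2 with hc1
    set c2 : Fin 2 → ℝ := ![z 0 - (z 0 + z 1 + z 2) / 3, z 1 - (z 0 + z 1 + z 2) / 3] with hc2
    refine ⟨Fin.append (Fin.append c1 c2) (fun j => x j - b), b, ?_⟩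
    rintro (j | ⟨i, j⟩)
    · rw [Fin.sum_univ_add, hx]
      simp [pyrPrismVert, Fin.append_left, Fin.append_right, Pi.single_apply]
    · rw [Fin.sum_univ_add, hyz]
      simp only [pyrPrismVert, Fin.append_left, Fin.append_right, Pi.zero_apply, mul_zero,
        Finset.sum_const_zero, add_zero]
      rw [Fin.sum_univ_add]
      simp only [Fin.append_left, Fin.append_right]
      fin_cases i <;> fin_cases j <;>
        simp [hc1, hc2, hb, segVert, triVert, Fin.sum_univ_two] <;> ring

theorem facetCount_le_of_combEquiv_pyrPrism {N k : ℕ} {P : Set (Fin N → ℝ)}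
    (h : CombEquiv P (pyrK k (prodP 1 2))) : facetCount P ≤ k + 5 := by
  classical
  rw [pyrK_prism] at h
  let u : Fin k ⊕ Fin 2 ⊕ Fin 3 → Fin k ⊕ Fin 2 × Fin 3 → ℝ
    | .inl j, i => i.elim (Pi.single j 1) 0
    | .inr (.inl a), i => i.elim 0 fun p => (Pi.single a 1 : Fin 2 → ℝ) p.1
    | .inr (.inr a), i => i.elim 0 fun p => (Pi.single a 1 : Fin 3 → ℝ) p.2
  have hs : ∀ {n : ℕ} (a b : Fin n), (0 : ℝ) ≤ (Pi.single a 1 : Fin n → ℝ) b := by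
    intro n a b
    by_cases h : b = a <;> simp [h]
  have hs' : ∀ {n : ℕ} (a b : Fin n), b ≠ a → (Pi.single a 1 : Fin n → ℝ) b = 0 := by
    intro n a b h
    simp [h]
  have := facetCount_le_of_combEquiv _ h u ?_ ?_ ?_ ?_
  · simpa using this
  · rintro (j | a | a) <;> rw [mem_affEval_pyrPrismVert]
    · exact ⟨Pi.single j 1, 0, 0, fun _ => rfl, fun _ _ => by simp [u]⟩
    · exact ⟨0, Pi.single a 1, 0, fun _ => rfl, fun _ _ => by simp [u]⟩
    · exact ⟨0, 0, Pi.single a 1, fun _ => rfl, fun _ _ => by simp [u]⟩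
  · rintro (j | a | a) (i | ⟨i, i'⟩) <;> simp only [u, Sum.elim_inl, Sum.elim_inr, Pi.zero_apply] <;>
      first | exact le_rfl | exact hs _ _
  · rintro (j | a | a) h
    · simpa [u] using congrFun h (.inl j)
    · simpa [u] using congrFun h (.inr (a, 0))
    · simpa [u] using congrFun h (.inr (0, a))
  · intro w hw hw0 hne
    obtain ⟨x, y, z, hx, hyz⟩ := mem_affEval_pyrPrismVert.1 hw
    by_cases hxz : ∃ j, x j ≠ 0
    · obtain ⟨j, hj⟩ := hxz
      refine ⟨.inl j, ?_⟩
      rintro (i | ⟨i, i'⟩) hi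
      · refine hs' j i ?_
        rintro rfl
        exact hj (by rw [← hx, hi])
      · rfl
    · push Not at hxz
      obtain ⟨i0, j0, h0⟩ : ∃ i j, y i + z j ≠ 0 := by
        by_contra! hcon
        apply hne
        ext i
        rcases i with j | ⟨i, j⟩
        · simp [hx, hxz]
        · simp [hyz, hcon]
      obtain ⟨i1, hi1⟩ := Finite.exists_min y
      have hnn : ∀ j, 0 ≤ z j + y i1 := fun j => by
        have := hw0 (.inr (i1, j))
        rw [hyz] at this
        linarith
      by_cases hlt : y i1 < y i0
      · refine ⟨.inr (.inl i0), ?_⟩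
        rintro (i | ⟨i, i'⟩) hi
        · rfl
        · refine hs' i0 i ?_
          rintro rfl
          rw [hyz] at hi
          linarith [hnn i']
      · have he : y i0 = y i1 := le_antisymm (not_lt.1 hlt) (hi1 i0)
        refine ⟨.inr (.inr j0), ?_⟩
        rintro (i | ⟨i, i'⟩) hi
        · rfl
        · refine hs' j0 i' ?_
          rintro rfl
          rw [hyz] at hi
          exact h0 (by linarith [hnn i', hi1 i])

theorem isFaceOf_empty {N : ℕ} (P : Set (Fin N → ℝ)) : IsFaceOf ∅ P :=
  ⟨0, 1, fun x _ => by simp, by simp⟩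

theorem isVertexOf_of_nonneg {ι : Type*} [Fintype ι] {N : ℕ} {t : ι → Fin N → ℝ} {w : ι → ℝ}
    (hw : w ∈ affEval t) (hw0 : ∀ i, 0 ≤ w i) {j : ι} (hj : ∀ i, w i = 0 ↔ i = j) :
    IsVertexOf (t j) (convexHull ℝ (range t)) ∧ ∀ i, t i = t j → i = j := by
  have h := isFaceOf_of_nonneg hw hw0
  have hz : {i | w i = 0} = {j} := by
    ext i
    simp [hj]
  rw [hz, image_singleton, convexHull_singleton] at h
  refine ⟨h.1, fun i hi => ?_⟩
  have : i ∈ ({j} : Set ι) := by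
    rw [← h.2]
    exact hi
  exact this

theorem pyrPrismVert_isVertexOf {k : ℕ} (j : Fin k ⊕ Fin 2 × Fin 3) :
    IsVertexOf (pyrPrismVert k j) (convexHull ℝ (range (pyrPrismVert k))) ∧
      ∀ i, pyrPrismVert k i = pyrPrismVert k j → i = j := by
  classical
  have hs : ∀ {n : ℕ} (a b : Fin n), (0 : ℝ) ≤ if b = a then 0 else 1 := by
    intro n a b
    split_ifs <;> norm_num
  rcases j with j | ⟨a, b⟩
  · refine isVertexOf_of_nonneg (w := Sum.elim (fun i => if i = j then 0 else 1) fun _ => 1)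
      (mem_affEval_pyrPrismVert.2 ⟨_, 1, 0, fun _ => rfl, fun _ _ => by simp⟩) ?_ ?_
    · rintro (i | i)
      · exact hs _ _
      · exact zero_le_one
    · rintro (i | i) <;> simp
  · refine isVertexOf_of_nonneg (w := Sum.elim (fun i => 1)
        fun p => (if p.1 = a then 0 else 1) + (if p.2 = b then 0 else 1))
      (mem_affEval_pyrPrismVert.2 ⟨1, fun i => if i = a then 0 else 1,
        fun i => if i = b then 0 else 1, fun _ => rfl, fun _ _ => rfl⟩) ?_ ?_
    · rintro (i | i)
      · exact zero_le_one
      · exact add_nonneg (hs _ _) (hs _ _)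
    · rintro (i | ⟨i, i'⟩)
      · simp
      · rw [Sum.elim_inr, add_eq_zero_iff_of_nonneg (hs _ _) (hs _ _)]
        simp

/-- A combinatorial equivalence cannot send distinct vertices of the target to the same vertex. -/
theorem card_le_of_combEquiv {N M n : ℕ} {ι : Type*} [Fintype ι] {v : Fin n → Fin N → ℝ}
    (hv : ∀ i, IsVertexOf (v i) (convexHull ℝ (range v))) {t : ι → Fin M → ℝ}
    (ht : ∀ j, IsVertexOf (t j) (convexHull ℝ (range t)) ∧ ∀ i, t i = t j → i = j)
    (h : CombEquiv (convexHull ℝ (range v)) (convexHull ℝ (range t))) :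
    Fintype.card ι ≤ n := by
  obtain ⟨φ, hφ⟩ := h
  have hφs : ∀ G₁ G₂, G₁.1 ⊆ G₂.1 ↔ (φ.symm G₁).1 ⊆ (φ.symm G₂).1 := by
    intro G₁ G₂
    rw [hφ, φ.apply_symm_apply, φ.apply_symm_apply]
  let tf : ι → {G // IsFaceOf G (convexHull ℝ (range t))} := fun j => ⟨{t j}, (ht j).1⟩
  let vf : Fin n → {G // IsFaceOf G (convexHull ℝ (range v))} := fun i => ⟨{v i}, hv i⟩
  have hex : ∀ j, ∃ i, v i ∈ (φ.symm (tf j)).1 := by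
    intro j
    by_contra! hcon
    obtain ⟨w, -, -, hwi, hwF⟩ := (φ.symm (tf j)).2.exists_nonneg
    have h0 : (φ.symm (tf j)).1 = ∅ := by
      rw [hwF, ← hwi]
      simp [hcon]
    have h1 : (tf j).1 ⊆ ∅ := by
      have := (hφs (tf j) ⟨∅, isFaceOf_empty _⟩).2 (by rw [h0]; exact empty_subset _)
      exact this
    exact h1 (mem_singleton (t j))
  choose f hf using hex
  have hinj : Function.Injective f := by
    intro j j' hjj
    have hsub : ∀ j, (φ (vf (f j))).1 ⊆ {t j} := by
      intro j
      have : (vf (f j)).1 ⊆ (φ.symm (tf j)).1 := singleton_subset_iff.2 (hf j)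
      rw [hφ, φ.apply_symm_apply] at this
      exact this
    have hne : (φ (vf (f j))).1.Nonempty := by
      rw [nonempty_iff_ne_empty]
      intro h0
      have h1 : (vf (f j)).1 ⊆ ∅ := by
        have := (hφ (vf (f j)) ⟨∅, isFaceOf_empty _⟩).2 (by rw [h0]; exact empty_subset _)
        exact this
      exact h1 (mem_singleton (v (f j)))
    obtain ⟨x, hx⟩ := hne
    have h1 : x = t j := hsub j hx
    have h2 : x = t j' := hsub j' (hjj ▸ hx)
    exact (ht j').2 j (h1.symm.trans h2)
  simpa using Fintype.card_le_of_injective f hinj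

end Models

section SlackCoordinates

variable {ι α : Type*} [Fintype ι] [Fintype α]

/-- A finite family `g` of nonnegative vectors generating the nonnegative cone of a subspace `W`
that contains the constants. -/
structure IsConeGenerator (W : Submodule ℝ (ι → ℝ)) (g : α → ι → ℝ) : Prop where
  one_mem : (1 : ι → ℝ) ∈ W
  mem : ∀ a, g a ∈ W
  nonneg : ∀ a i, 0 ≤ g a i
  gen : ∀ w ∈ W, (∀ i, 0 ≤ w i) → ∃ l : α → ℝ, (∀ a, 0 ≤ l a) ∧ w = ∑ a, l a • g a

namespace IsConeGenerator

variable {W : Submodule ℝ (ι → ℝ)} {g : α → ι → ℝ}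

theorem exists_eq_sum (h : IsConeGenerator W g) {w : ι → ℝ} (hw : w ∈ W) :
    ∃ c : α → ℝ, w = ∑ a, c a • g a := by
  have hs : ∀ i, |w i| ≤ ∑ i, |w i| := fun i =>
    Finset.single_le_sum (f := fun i => |w i|) (fun i _ => abs_nonneg _) (Finset.mem_univ i)
  have h0 : 0 ≤ ∑ i, |w i| := Finset.sum_nonneg fun i _ => abs_nonneg _
  obtain ⟨l, -, hl⟩ := h.gen (w + (∑ i, |w i|) • 1) (W.add_mem hw (W.smul_mem _ h.one_mem))
    (fun i => by
      have := hs i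
      have := neg_abs_le (w i)
      simp only [Pi.add_apply, Pi.smul_apply, Pi.one_apply, smul_eq_mul, mul_one]
      linarith)
  obtain ⟨m, -, hm⟩ := h.gen ((∑ i, |w i|) • 1) (W.smul_mem _ h.one_mem)
    (fun i => by simpa using h0)
  refine ⟨l - m, ?_⟩
  simp only [Pi.sub_apply, sub_smul, Finset.sum_sub_distrib]
  rw [← hl, ← hm, add_sub_cancel_right]

theorem range_linearCombination (h : IsConeGenerator W g) :
    LinearMap.range (Fintype.linearCombination ℝ g) = W := by
  ext w
  constructor
  · rintro ⟨c, rfl⟩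
    rw [Fintype.linearCombination_apply]
    exact W.sum_mem fun a _ => W.smul_mem _ (h.mem a)
  · intro hw
    obtain ⟨c, hc⟩ := h.exists_eq_sum hw
    exact ⟨c, by rw [Fintype.linearCombination_apply, hc]⟩

theorem finrank_add_finrank_ker (h : IsConeGenerator W g) :
    Module.finrank ℝ W + Module.finrank ℝ (LinearMap.ker (Fintype.linearCombination ℝ g)) =
      Fintype.card α := by
  have := LinearMap.finrank_range_add_finrank_ker (Fintype.linearCombination ℝ g)
  rwa [h.range_linearCombination, Module.finrank_fintype_fun_eq_card] at this

theorem exists_pos_sum_eq_one (h : IsConeGenerator W g) :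
    ∃ m : α → ℝ, (∀ a, 0 < m a) ∧ ∑ a, m a • g a = 1 := by
  obtain ⟨ε, hε, hle⟩ := exists_pos_mul_abs_le (1 : ι → ℝ) (∑ a, g a) (fun _ => zero_le_one)
    (fun i hi => absurd hi one_ne_zero)
  obtain ⟨l, hl0, hl⟩ := h.gen (1 - ε • ∑ a, g a)
    (W.sub_mem h.one_mem (W.smul_mem _ (W.sum_mem fun a _ => h.mem a))) (fun i => by
      have h1 := hle i
      have h2 := mul_le_mul_of_nonneg_left (le_abs_self ((∑ a, g a) i)) hε.le
      simp only [Pi.sub_apply, Pi.smul_apply, smul_eq_mul]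
      linarith)
  refine ⟨fun a => ε + l a, fun a => add_pos_of_pos_of_nonneg hε (hl0 a), ?_⟩
  simp only [add_smul, Finset.sum_add_distrib, ← Finset.smul_sum]
  rw [← hl]
  abel

theorem mem_convexHull (h : IsConeGenerator W g) {m : α → ℝ} (hm1 : ∑ a, m a • g a = 1)
    {y : α → ℝ} (hy0 : ∀ a, 0 ≤ y a) (hym : ∑ a, m a * y a = 1)
    (hyk : ∀ k : α → ℝ, ∑ a, k a • g a = 0 → ∑ a, k a * y a = 0) :
    y ∈ convexHull ℝ (range fun i a => g a i) := by
  classical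
  by_contra hcon
  obtain ⟨f, u, hfy, hfu⟩ := geometric_hahn_banach_point_closed (convex_convexHull ℝ _)
    ((finite_range fun i a => g a i).isCompact_convexHull ℝ).isClosed hcon
  set c : α → ℝ := fun a => f (Pi.single a 1) with hc
  have hf : ∀ y, f y = ∑ a, c a * y a := by
    intro y
    have := (f : (α → ℝ) →ₗ[ℝ] ℝ).pi_apply_eq_sum_univ y
    rw [ContinuousLinearMap.coe_coe] at this
    rw [this]
    refine Finset.sum_congr rfl fun k _ => ?_
    rw [smul_eq_mul, mul_comm, hc]
    congr 2
    ext j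
    simp [Pi.single_apply, eq_comm]
  obtain ⟨l, hl0, hl⟩ := h.gen (∑ a, c a • g a - u • 1)
    (W.sub_mem (W.sum_mem fun a _ => W.smul_mem _ (h.mem a)) (W.smul_mem _ h.one_mem))
    (fun i => by
      have := hfu _ (subset_convexHull ℝ _ (mem_range_self i))
      rw [hf] at this
      simp only [Pi.sub_apply, Finset.sum_apply, Pi.smul_apply, smul_eq_mul, Pi.one_apply, mul_one]
      linarith)
  have hk := hyk (fun a => c a - u * m a - l a) (by
    simp only [sub_smul, Finset.sum_sub_distrib, mul_smul, ← Finset.smul_sum]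
    rw [hm1, ← hl, sub_self])
  simp only [sub_mul, Finset.sum_sub_distrib, mul_assoc, ← Finset.mul_sum] at hk
  rw [hym, ← hf] at hk
  have : 0 ≤ ∑ a, l a * y a := Finset.sum_nonneg fun a _ => mul_nonneg (hl0 a) (hy0 a)
  linarith

end IsConeGenerator

theorem sum_trichotomy {β : Type*} [AddCommMonoid β] (k : α → ℝ) (F : α → β) :
    ∑ a, F a = ∑ a : {a // k a = 0}, F a + (∑ a : {a // 0 < k a}, F a +
      ∑ a : {a // k a < 0}, F a) := by
  classical
  have hsub : ∀ p : α → Prop, ∑ a : {a // p a}, F a = ∑ a, if p a then F a else 0 := by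
    intro p
    rw [← Finset.sum_filter, Finset.sum_subtype (Finset.univ.filter p) (p := p) (by simp)]
  rw [hsub, hsub, hsub, ← Finset.sum_add_distrib, ← Finset.sum_add_distrib]
  refine Finset.sum_congr rfl fun a _ => ?_
  rcases lt_trichotomy (k a) 0 with h | h | h
  · simp [h, h.ne, h.not_gt]
  · simp [h]
  · simp [h, h.ne', h.not_gt]

/-- Index set for the vertices of the section of a simplex by the hyperplane `k = 0`. -/
abbrev SectionIndex (k : α → ℝ) : Type _ := {a // k a = 0} ⊕ ({a // 0 < k a} × {a // k a < 0})

/-- The coefficient normalizing the vertex on the edge between the facets `i` and `j`. -/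
def edgeCoeff (m k : α → ℝ) (p : {a // 0 < k a} × {a // k a < 0}) : ℝ :=
  (m p.1 * (k p.1)⁻¹ + m p.2 * (-k p.2)⁻¹)⁻¹

open Classical in
/-- The vertices of `{y ≥ 0 | m ⬝ y = 1, k ⬝ y = 0}`. -/
def sectionVert (m k : α → ℝ) : SectionIndex k → α → ℝ
  | .inl a => Pi.single a.1 (m a)⁻¹
  | .inr p => edgeCoeff m k p • (Pi.single p.1.1 (k p.1)⁻¹ + Pi.single p.2.1 (-k p.2)⁻¹)

theorem edgeCoeff_pos {β : Type*} {m k : β → ℝ} (hm : ∀ a, 0 < m a) (p) : 0 < edgeCoeff m k p := by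
  have h1 := hm p.1
  have h2 := hm p.2
  have h3 := p.1.2
  have h4 : 0 < -k p.2 := neg_pos.2 p.2.2
  unfold edgeCoeff
  positivity

theorem sum_mul_sectionVert (m k : α → ℝ) (c : α → ℝ) (j : SectionIndex k) :
    ∑ a, c a * sectionVert m k j a = j.elim (fun a : {a // k a = 0} => c a * (m a)⁻¹)
      fun p => edgeCoeff m k p * (c p.1 * (k p.1)⁻¹ + c p.2 * (-k p.2)⁻¹) := by
  classical
  rcases j with a | p
  · simp [sectionVert, Pi.single_apply]
  · simp only [sectionVert, Sum.elim_inr, Pi.smul_apply, Pi.add_apply, smul_eq_mul, mul_add,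
      Finset.sum_add_distrib, Pi.single_apply, mul_ite, mul_zero, Finset.sum_ite_eq',
      Finset.mem_univ, if_true]
    ring

theorem sectionVert_nonneg {β : Type*} {m k : β → ℝ} (hm : ∀ a, 0 < m a) (j : SectionIndex k) (a : β) :
    0 ≤ sectionVert m k j a := by
  classical
  have hs : ∀ (b : β) (r : ℝ), 0 ≤ r → 0 ≤ (Pi.single b r : β → ℝ) a := by
    intro b r hr
    rw [Pi.single_apply]
    split_ifs
    · exact hr
    · exact le_rfl
  rcases j with b | p
  · exact hs _ _ (inv_pos.2 (hm b)).le
  · exact mul_nonneg (edgeCoeff_pos hm p).le (add_nonneg (hs _ _ (inv_pos.2 p.1.2).le)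
      (hs _ _ (inv_pos.2 (neg_pos.2 p.2.2)).le))

theorem sum_left_mul_sectionVert {m k : α → ℝ} (hm : ∀ a, 0 < m a) (j : SectionIndex k) :
    ∑ a, m a * sectionVert m k j a = 1 := by
  rw [sum_mul_sectionVert]
  rcases j with a | p
  · exact mul_inv_cancel₀ (hm a).ne'
  · exact inv_mul_cancel₀ (inv_pos.1 (edgeCoeff_pos hm p)).ne'

theorem sum_kernel_mul_sectionVert (m k : α → ℝ) (j : SectionIndex k) :
    ∑ a, k a * sectionVert m k j a = 0 := by
  rw [sum_mul_sectionVert]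
  rcases j with a | p
  · simp [a.2]
  · have h1 := p.1.2.ne'
    have h2 := p.2.2.ne
    simp only [Sum.elim_inr]
    field_simp
    ring

theorem sum_product_div {P Q : Type*} [Fintype P] [Fintype Q] (p : P → ℝ) (q : Q → ℝ)
    (hp : ∀ i, 0 ≤ p i) (hq : ∀ j, 0 ≤ q j) (hpq : ∑ i, p i = ∑ j, q j) (x : P → ℝ) (z : Q → ℝ) :
    ∑ t : P × Q, p t.1 * q t.2 / (∑ i, p i) * (x t.1 + z t.2) =
      ∑ i, p i * x i + ∑ j, q j * z j := by
  rcases eq_or_ne (∑ i, p i) 0 with h | h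
  · have h1 : ∀ i, p i = 0 := fun i =>
      (Finset.sum_eq_zero_iff_of_nonneg fun i _ => hp i).1 h i (Finset.mem_univ i)
    have h2 : ∀ j, q j = 0 := fun j =>
      (Finset.sum_eq_zero_iff_of_nonneg fun j _ => hq j).1 (hpq ▸ h) j (Finset.mem_univ j)
    simp [h1, h2]
  · set S := ∑ i, p i with hS
    rw [Fintype.sum_prod_type]
    have h1 : ∀ i, ∑ j, p i * q j / S * (x i + z j) = p i * x i + p i / S * ∑ j, q j * z j := by
      intro i
      have : ∀ j, p i * q j / S * (x i + z j) = p i / S * x i * q j + p i / S * (q j * z j) :=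
        fun j => by ring
      simp only [this, Finset.sum_add_distrib, ← Finset.mul_sum, ← hpq]
      field_simp
    simp only [h1, Finset.sum_add_distrib, ← Finset.sum_mul, ← Finset.sum_div]
    rw [← hS, div_self h, one_mul]

theorem mem_convexHull_sectionVert {m k y : α → ℝ} (hm : ∀ a, 0 < m a) (hy0 : ∀ a, 0 ≤ y a)
    (hym : ∑ a, m a * y a = 1) (hyk : ∑ a, k a * y a = 0) :
    y ∈ convexHull ℝ (range (sectionVert m k)) := by
  classical
  set p : {a // 0 < k a} → ℝ := fun i => k i * y i with hp
  set q : {a // k a < 0} → ℝ := fun i => -k i * y i with hq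
  have hp0 : ∀ i, 0 ≤ p i := fun i => mul_nonneg i.2.le (hy0 i)
  have hq0 : ∀ i, 0 ≤ q i := fun i => mul_nonneg (neg_pos.2 i.2).le (hy0 i)
  have hpq : ∑ i, p i = ∑ i, q i := by
    rw [sum_trichotomy k] at hyk
    have h0 : ∑ a : {a // k a = 0}, k a * y a = 0 := Finset.sum_eq_zero fun a _ => by simp [a.2]
    simp only [hp, hq, neg_mul, Finset.sum_neg_distrib]
    linarith
  set w : SectionIndex k → ℝ := Sum.elim (fun a => m a * y a)
    (fun t => p t.1 * q t.2 / (∑ i, p i) * (edgeCoeff m k t)⁻¹) with hw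
  have hsum : ∀ c : α → ℝ, ∑ j, w j * ∑ a, c a * sectionVert m k j a = ∑ a, c a * y a := by
    intro c
    simp only [sum_mul_sectionVert]
    rw [Fintype.sum_sum_type, sum_trichotomy k (fun a => c a * y a)]
    simp only [hw, Sum.elim_inl, Sum.elim_inr]
    congr 1
    · refine Finset.sum_congr rfl fun a _ => ?_
      have := (hm a).ne'
      field_simp
    · have h1 : ∀ t : {a // 0 < k a} × {a // k a < 0},
          p t.1 * q t.2 / (∑ i, p i) * (edgeCoeff m k t)⁻¹ *
            (edgeCoeff m k t * (c t.1 * (k t.1)⁻¹ + c t.2 * (-k t.2)⁻¹)) =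
          p t.1 * q t.2 / (∑ i, p i) * (c t.1 * (k t.1)⁻¹ + c t.2 * (-k t.2)⁻¹) := by
        intro t
        rw [mul_assoc, inv_mul_cancel_left₀ (edgeCoeff_pos hm t).ne']
      simp only [h1]
      rw [sum_product_div p q hp0 hq0 hpq (fun i => c i * (k i)⁻¹) (fun j => c j * (-k j)⁻¹)]
      congr 1
      · refine Finset.sum_congr rfl fun a _ => ?_
        have := a.2.ne'
        simp only [hp]
        field_simp
      · refine Finset.sum_congr rfl fun a _ => ?_
        have := a.2.ne
        simp only [hq]
        field_simp
  rw [mem_convexHull_range_iff]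
  refine ⟨w, ?_, ?_, ?_⟩
  · rintro (a | t)
    · exact mul_nonneg (hm a).le (hy0 a)
    · have := edgeCoeff_pos hm t
      have := hp0 t.1
      have := hq0 t.2
      have : 0 ≤ ∑ i, p i := Finset.sum_nonneg fun i _ => hp0 i
      simp only [hw, Sum.elim_inr]
      positivity
  · have := hsum m
    simpa only [sum_left_mul_sectionVert hm, mul_one, hym] using this
  · ext a
    have := hsum (Pi.single a 1)
    simpa [Pi.single_apply, Finset.sum_apply] using this

/-- The points `t j` are affinely equivalent to the vertices `sectionVert m k j`: both have the
same affine functionals. -/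
def RealizesSection {N : ℕ} (m k : α → ℝ) (t : SectionIndex k → Fin N → ℝ) : Prop :=
  ∀ w : SectionIndex k → ℝ,
    w ∈ affEval t ↔ ∃ c : α → ℝ, ∀ j, w j = ∑ a, c a * sectionVert m k j a

theorem exists_sectionVert_image {N : ℕ} {p : ι → Fin N → ℝ} {W : Submodule ℝ (ι → ℝ)}
    {g : α → ι → ℝ} (h : IsConeGenerator W g) (hpW : affEval p ≤ W) {m k : α → ℝ}
    (hm : ∀ a, 0 < m a) (hm1 : ∑ a, m a • g a = 1) (hk : ∑ a, k a • g a = 0)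
    (hspan : ∀ l : α → ℝ, ∑ a, l a • g a = 0 → ∃ s : ℝ, l = s • k) :
    ∃ t : SectionIndex k → Fin N → ℝ, convexHull ℝ (range p) = convexHull ℝ (range t) ∧
      (W = affEval p → RealizesSection m k t) := by
  classical
  have hcoord : ∀ x : Fin N, ∃ c : α → ℝ, (fun i => p i x) = ∑ a, c a • g a := fun x =>
    h.exists_eq_sum (hpW (mem_affEval.2 ⟨Pi.single x 1, 0, fun i => by simp [Pi.single_apply]⟩))
  choose C hC using hcoord
  let T : (α → ℝ) →ₗ[ℝ] (Fin N → ℝ) := LinearMap.pi fun x => ∑ a, C x a • LinearMap.proj a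
  have hT : ∀ y x, T y x = ∑ a, C x a * y a := fun y x => by simp [T]
  have hTp : ∀ i, T (fun a => g a i) = p i := by
    intro i
    ext x
    rw [hT]
    have := congrFun (hC x) i
    simpa [Finset.sum_apply] using this.symm
  have hU : ∀ j, sectionVert m k j ∈ convexHull ℝ (range fun i a => g a i) := by
    intro j
    refine h.mem_convexHull hm1 (sectionVert_nonneg hm j) (sum_left_mul_sectionVert hm j) ?_
    intro l hl
    obtain ⟨s, rfl⟩ := hspan l hl
    simp only [Pi.smul_apply, smul_eq_mul, mul_assoc, ← Finset.mul_sum,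
      sum_kernel_mul_sectionVert, mul_zero]
  have hsum : ∀ (c : α → ℝ) i, (∑ a, c a • g a) i = ∑ a, c a * g a i := fun c i => by
    simp [Finset.sum_apply]
  have hconv : convexHull ℝ (range fun i a => g a i) = convexHull ℝ (range (sectionVert m k)) := by
    apply Subset.antisymm
    · refine convexHull_min ?_ (convex_convexHull ℝ _)
      rintro _ ⟨i, rfl⟩
      refine mem_convexHull_sectionVert hm (fun a => h.nonneg a i) ?_ ?_
      · rw [← hsum, hm1, Pi.one_apply]
      · rw [← hsum, hk, Pi.zero_apply]
    · refine convexHull_min ?_ (convex_convexHull ℝ _)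
      rintro _ ⟨j, rfl⟩
      exact hU j
  refine ⟨fun j => T (sectionVert m k j), ?_, ?_⟩
  · have e1 : range p = T '' range fun i a => g a i := by
      rw [← range_comp]
      exact congrArg range (funext fun i => (hTp i).symm)
    have e2 : (range fun j => T (sectionVert m k j)) = T '' range (sectionVert m k) := by
      rw [← range_comp]
      rfl
    rw [e1, e2, ← T.image_convexHull, ← T.image_convexHull, hconv]
  · rintro rfl w
    rw [mem_affEval]
    constructor
    · rintro ⟨c, b, hcb⟩
      refine ⟨fun a => ∑ x, c x * C x a + b * m a, fun j => ?_⟩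
      rw [← hcb j]
      simp only [add_mul, Finset.sum_add_distrib, mul_assoc, ← Finset.mul_sum,
        sum_left_mul_sectionVert hm, hT, Finset.sum_mul, mul_one]
      congr 1
      simp only [Finset.mul_sum]
      exact Finset.sum_comm
    · rintro ⟨c, hc⟩
      obtain ⟨γ, b, hγ⟩ := mem_affEval.1
        ((affEval p).sum_mem fun a (_ : a ∈ Finset.univ) => (affEval p).smul_mem (c a) (h.mem a))
      refine ⟨γ, b, fun j => ?_⟩
      obtain ⟨u, -, hu1, hu⟩ := (mem_convexHull_range_iff _ _).1 (hU j)
      rw [hc, ← hu, map_sum]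
      simp only [map_smul, hTp]
      rw [affine_sum p u hu1]
      simp only [hγ, hsum, Finset.sum_apply, Pi.smul_apply, smul_eq_mul, Finset.mul_sum]
      rw [Finset.sum_comm]
      exact Finset.sum_congr rfl fun a _ => Finset.sum_congr rfl fun i _ => by ring

namespace RealizesSection

variable {N : ℕ} {m k : α → ℝ} {t : SectionIndex k → Fin N → ℝ}

theorem mem_affEval_iff (h : RealizesSection m k t) {w : SectionIndex k → ℝ} :
    w ∈ affEval t ↔ ∃ c : α → ℝ, (∀ a : {a // k a = 0}, w (.inl a) = c a * (m a)⁻¹) ∧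
      ∀ i j, w (.inr (i, j)) = edgeCoeff m k (i, j) * (c i * (k i)⁻¹ + c j * (-k j)⁻¹) := by
  rw [h]
  simp only [sum_mul_sectionVert, Sum.forall, Prod.forall, Sum.elim_inl, Sum.elim_inr]

theorem isVertexOf (h : RealizesSection m k t) (hm : ∀ a, 0 < m a) (j : SectionIndex k) :
    IsVertexOf (t j) (convexHull ℝ (range t)) ∧ ∀ i, t i = t j → i = j := by
  classical
  have key : ∀ S : Set α, (∀ j', (match j' with
        | .inl a => (a : α) ∈ S
        | .inr p => (p.1 : α) ∈ S ∧ (p.2 : α) ∈ S) ↔ j' = j) →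
      IsVertexOf (t j) (convexHull ℝ (range t)) ∧ ∀ i, t i = t j → i = j := by
    intro S hS
    let c : α → ℝ := fun a => if a ∈ S then 0 else 1
    have hc0 : ∀ a, 0 ≤ c a := fun a => by simp only [c]; split_ifs <;> norm_num
    have hc : ∀ a, c a = 0 ↔ a ∈ S := fun a => by simp [c]
    have hpos : ∀ p : {a // 0 < k a} × {a // k a < 0},
        0 ≤ c p.1 * (k p.1)⁻¹ ∧ 0 ≤ c p.2 * (-k p.2)⁻¹ := fun p =>
      ⟨mul_nonneg (hc0 _) (inv_pos.2 p.1.2).le,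
        mul_nonneg (hc0 _) (inv_pos.2 (neg_pos.2 p.2.2)).le⟩
    refine isVertexOf_of_nonneg ((h (fun j => ∑ a, c a * sectionVert m k j a)).2
      ⟨c, fun _ => rfl⟩) (fun i => Finset.sum_nonneg fun a _ =>
        mul_nonneg (hc0 a) (sectionVert_nonneg hm i a)) fun i => ?_
    rw [← hS i, sum_mul_sectionVert]
    rcases i with a | p
    · simp [(hm a).ne', hc]
    · simp only [Sum.elim_inr, mul_eq_zero, (edgeCoeff_pos hm p).ne', false_or]
      rw [add_eq_zero_iff_of_nonneg (hpos p).1 (hpos p).2]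
      simp [hc, p.1.2.ne', p.2.2.ne]
  rcases j with a | ⟨⟨i, hi⟩, ⟨j, hj⟩⟩
  · refine key {a.1} ?_
    rintro (b | ⟨⟨x, hx⟩, ⟨y, hy⟩⟩)
    · simp [Subtype.ext_iff]
    · simp only [mem_singleton_iff, reduceCtorEq, iff_false]
      rintro ⟨rfl, -⟩
      exact hx.ne' a.2
  · refine key {i, j} ?_
    rintro (b | ⟨⟨x, hx⟩, ⟨y, hy⟩⟩)
    · simp only [mem_insert_iff, mem_singleton_iff, reduceCtorEq, iff_false]
      rintro (hb | hb)
      · exact hi.ne' (hb ▸ b.2)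
      · exact hj.ne (hb ▸ b.2)
    · simp only [mem_insert_iff, mem_singleton_iff, Sum.inr.injEq, Prod.mk.injEq, Subtype.mk.injEq]
      constructor
      · rintro ⟨rfl | rfl, rfl | rfl⟩
        · exact absurd hx hy.not_gt
        · exact ⟨rfl, rfl⟩
        · exact absurd hi hy.not_gt
        · exact absurd hx hy.not_gt
      · rintro ⟨rfl, rfl⟩
        exact ⟨.inl rfl, .inr rfl⟩

theorem vertexCount_eq (h : RealizesSection m k t) (hm : ∀ a, 0 < m a) :
    vertexCount (convexHull ℝ (range t)) = Fintype.card (SectionIndex k) := by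
  have : vertexSet (convexHull ℝ (range t)) = range t := by
    apply Subset.antisymm (vertexSet_convexHull_range_subset t)
    rintro _ ⟨j, rfl⟩
    exact (h.isVertexOf hm j).1
  rw [vertexCount, this, ← image_univ,
    ncard_image_of_injective _ fun i j hij => (h.isVertexOf hm j).2 i hij, ncard_univ,
    Nat.card_eq_fintype_card]

theorem combEquiv_pyrPrism (h : RealizesSection m k t) (hm : ∀ a, 0 < m a) {z : ℕ}
    (hz : Fintype.card {a // k a = 0} = z) (hp : Fintype.card {a // 0 < k a} = 2)
    (hn : Fintype.card {a // k a < 0} = 3) :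
    CombEquiv (convexHull ℝ (range t)) (pyrK z (prodP 1 2)) := by
  classical
  let e0 := Fintype.equivFinOfCardEq hz
  let ep := Fintype.equivFinOfCardEq hp
  let en := Fintype.equivFinOfCardEq hn
  let e : SectionIndex k ≃ Fin z ⊕ Fin 2 × Fin 3 := Equiv.sumCongr e0 (Equiv.prodCongr ep en)
  let s : Fin z ⊕ Fin 2 × Fin 3 → Fin N → ℝ := t ∘ e.symm
  have hs : ∀ w, w ∈ affEval s ↔ (w ∘ e) ∈ affEval t := by
    intro w
    rw [mem_affEval, mem_affEval]
    refine exists_congr fun c => exists_congr fun b => ?_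
    rw [← e.forall_congr_right]
    simp [s]
  have hrange : range t = range s := (EquivLike.range_comp t e.symm).symm
  rw [hrange, pyrK_prism]
  let r : Fin z ⊕ Fin 2 × Fin 3 → ℝ :=
    Sum.elim 1 fun p => (edgeCoeff m k (ep.symm p.1, en.symm p.2))⁻¹
  have hec := fun p => (edgeCoeff_pos hm p : 0 < edgeCoeff m k p)
  refine combEquiv_of_scaling s (pyrPrismVert z) r ?_ ?_ ?_
  · rintro (i | p)
    · exact one_pos
    · exact inv_pos.2 (hec _)
  · intro w hw
    obtain ⟨c, hc1, hc2⟩ := h.mem_affEval_iff.1 ((hs w).1 hw)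
    refine mem_affEval_pyrPrismVert.2 ⟨fun i => w (.inl i),
      fun i => c (ep.symm i) * (k (ep.symm i))⁻¹, fun j => c (en.symm j) * (-k (en.symm j))⁻¹,
      fun i => by simp [r], fun i j => ?_⟩
    have := hc2 (ep.symm i) (en.symm j)
    simp only [Function.comp, e, Equiv.sumCongr_apply, Sum.map_inr, Equiv.prodCongr_apply,
      Prod.map, Equiv.apply_symm_apply] at this
    simp only [r, Sum.elim_inr]
    rw [this, inv_mul_cancel_left₀ (hec _).ne']
  · intro w hw
    obtain ⟨x, y, u, h1, h2⟩ := mem_affEval_pyrPrismVert.1 hw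
    rw [hs, h.mem_affEval_iff]
    refine ⟨fun a => if h0 : k a = 0 then m a * x (e0 ⟨a, h0⟩) else
      if h0 : 0 < k a then k a * y (ep ⟨a, h0⟩) else
      if h0 : k a < 0 then -k a * u (en ⟨a, h0⟩) else 0, ?_, ?_⟩
    · rintro ⟨a, ha⟩
      have := (hm a).ne'
      simp only [Function.comp, e, Equiv.sumCongr_apply, Sum.map_inl, r, Sum.elim_inl, h1, ha,
        dif_pos, Pi.one_apply, inv_one, one_mul]
      field_simp
    · rintro ⟨a, ha⟩ ⟨b, hb⟩
      have h3 := ha.ne'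
      have h4 := hb.ne
      simp only [Function.comp, e, Equiv.sumCongr_apply, Sum.map_inr, Equiv.prodCongr_apply,
        Prod.map, Equiv.symm_apply_apply, r, Sum.elim_inr, inv_inv, h2, dif_pos, ha, hb, h3, h4,
        hb.not_gt, dif_neg, not_false_eq_true]
      congr 1
      field_simp

end RealizesSection

end SlackCoordinates

section Projections

theorem exists_projection_cone_data {N e : ℕ} {Q : Set (Fin e → ℝ)} (hQ : IsPolytope Q)
    (π : (Fin e → ℝ) →ᵃ[ℝ] (Fin N → ℝ)) :
    ∃ (n : ℕ) (p : Fin n → Fin N → ℝ) (W : Submodule ℝ (Fin n → ℝ))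
      (g : Fin (facetCount Q) → Fin n → ℝ),
      π '' Q = convexHull ℝ (range p) ∧ affEval p ≤ W ∧ IsConeGenerator W g := by
  obtain ⟨S, rfl⟩ := hQ
  let q : Fin S.card → Fin e → ℝ := fun i => S.equivFin.symm i
  have hq : (S : Set (Fin e → ℝ)) = range q := by
    have : range q = range (Subtype.val : S → Fin e → ℝ) :=
      EquivLike.range_comp (Subtype.val : S → Fin e → ℝ) S.equivFin.symm
    rw [this]
    exact Subtype.range_coe.symm
  rw [hq]
  obtain ⟨g, hg, hg0, hgen⟩ := exists_facet_generators q
  refine ⟨_, π ∘ q, affEval q, g, ?_, affEval_comp_le q π, one_mem_affEval q, hg, hg0, hgen⟩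
  rw [π.image_convexHull, range_comp]

theorem combEquiv_of_facetCount_le {N d e : ℕ} {P : Set (Fin N → ℝ)} (hd : pdim P = d)
    (hv : vertexCount P = d + 3) {Q : Set (Fin e → ℝ)} (hQ : IsPolytope Q)
    {π : (Fin e → ℝ) →ᵃ[ℝ] (Fin N → ℝ)} (hπ : π '' Q = P) (hle : facetCount Q ≤ d + 2) :
    facetCount Q = d + 2 ∧ CombEquiv P (pyrK (d - 3) (prodP 1 2)) := by
  obtain ⟨n, p, W, g, hP, hpW, hg⟩ := exists_projection_cone_data hQ π
  rw [hπ] at hP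
  have hpdim : Module.finrank ℝ (affEval p) = d + 1 := by
    have := pdim_convexHull_range p
    rw [← hP, hd] at this
    exact_mod_cast this.symm
  have hWdim : d + 1 ≤ Module.finrank ℝ W := hpdim ▸ Submodule.finrank_mono hpW
  have hrank := hg.finrank_add_finrank_ker
  rw [Fintype.card_fin] at hrank
  obtain ⟨m, hm, hm1⟩ := hg.exists_pos_sum_eq_one
  have hker : ∀ l : Fin (facetCount Q) → ℝ,
      l ∈ LinearMap.ker (Fintype.linearCombination ℝ g) ↔ ∑ a, l a • g a = 0 := fun l => by
    rw [LinearMap.mem_ker, Fintype.linearCombination_apply]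
  obtain ⟨⟨k, hk⟩, hspan⟩ := finrank_le_one_iff.1
    (by omega : Module.finrank ℝ (LinearMap.ker (Fintype.linearCombination ℝ g)) ≤ 1)
  rw [hker] at hk
  replace hspan : ∀ l : Fin (facetCount Q) → ℝ, ∑ a, l a • g a = 0 → ∃ s : ℝ, l = s • k := by
    intro l hl
    obtain ⟨s, hs⟩ := hspan ⟨l, (hker l).2 hl⟩
    exact ⟨s, (congrArg Subtype.val hs).symm⟩
  suffices main : ∀ k : Fin (facetCount Q) → ℝ, ∑ a, k a • g a = 0 →
      (∀ l : Fin (facetCount Q) → ℝ, ∑ a, l a • g a = 0 → ∃ s : ℝ, l = s • k) →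
      Fintype.card {a // 0 < k a} ≤ Fintype.card {a // k a < 0} →
      facetCount Q = d + 2 ∧ CombEquiv P (pyrK (d - 3) (prodP 1 2)) by
    rcases le_total (Fintype.card {a // 0 < k a}) (Fintype.card {a // k a < 0}) with h | h
    · exact main k hk hspan h
    · refine main (-k) (by simpa using hk) (fun l hl => ?_) (by simpa using h)
      obtain ⟨s, rfl⟩ := hspan l hl
      exact ⟨-s, by simp⟩
  clear! k
  intro k hk hspan hcard
  obtain ⟨t, ht, hreal⟩ := exists_sectionVert_image hg hpW hm hm1 hk hspan
  rw [← hP] at ht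
  have hcount := sum_trichotomy k fun _ => 1
  simp only [Finset.sum_const, Finset.card_univ, smul_eq_mul, mul_one, Fintype.card_fin] at hcount
  have hJ : Fintype.card (SectionIndex k) = Fintype.card {a // k a = 0} +
      Fintype.card {a // 0 < k a} * Fintype.card {a // k a < 0} := by
    rw [Fintype.card_sum, Fintype.card_prod]
  have hvle : d + 3 ≤ Fintype.card (SectionIndex k) := by
    rw [← hv, vertexCount, ht]
    refine (ncard_le_ncard (vertexSet_convexHull_range_subset t) (finite_range t)).trans ?_
    rw [← image_univ]
    refine (ncard_image_le finite_univ).trans ?_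
    rw [ncard_univ, Nat.card_eq_fintype_card]
  have hker0 : Module.finrank ℝ (LinearMap.ker (Fintype.linearCombination ℝ g)) ≠ 0 := by
    intro h0
    have : k = 0 := (Submodule.mem_bot ℝ).1 (Submodule.finrank_eq_zero.1 h0 ▸ (hker k).2 hk)
    have hx0 : Fintype.card {a // 0 < k a} = 0 := by simp [this]
    rw [hx0] at hcount hJ
    omega
  have hQd : facetCount Q = d + 2 := by omega
  replace hreal := hreal (Submodule.eq_of_le_of_finrank_eq hpW (by omega)).symm
  have hvc := hreal.vertexCount_eq hm
  rw [← ht, hv, hJ] at hvc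
  replace hcount := hQd.symm.trans hcount
  generalize hz : Fintype.card {a // k a = 0} = z at *
  generalize hp : Fintype.card {a // 0 < k a} = x at *
  generalize hn : Fintype.card {a // k a < 0} = y at *
  have hx : x ≤ 2 := by
    by_contra! hx
    nlinarith
  have hxy : x = 2 ∧ y = 3 := by
    interval_cases x <;> omega
  obtain ⟨rfl, rfl⟩ := hxy
  obtain rfl : z = d - 3 := by omega
  exact ⟨hQd, ht ▸ hreal.combEquiv_pyrPrism hm hz hp hn⟩

theorem exists_xc_eq {N e : ℕ} {P : Set (Fin N → ℝ)} {Q : Set (Fin e → ℝ)} (hQ : IsPolytope Q)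
    {π : (Fin e → ℝ) →ᵃ[ℝ] (Fin N → ℝ)} (hπ : π '' Q = P) :
    xc P ≤ facetCount Q ∧
      ∃ (e' : ℕ) (Q' : Set (Fin e' → ℝ)) (π' : (Fin e' → ℝ) →ᵃ[ℝ] (Fin N → ℝ)),
        IsPolytope Q' ∧ π' '' Q' = P ∧ facetCount Q' = xc P :=
  ⟨Nat.sInf_le ⟨e, Q, π, hQ, hπ, rfl⟩,
    Nat.sInf_mem (s := {n | ∃ (e : ℕ) (Q : Set (Fin e → ℝ)) (π : (Fin e → ℝ) →ᵃ[ℝ] (Fin N → ℝ)),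
      IsPolytope Q ∧ π '' Q = P ∧ facetCount Q = n}) ⟨_, e, Q, π, hQ, hπ, rfl⟩⟩

theorem xc_le_vertexCount {N : ℕ} {P : Set (Fin N → ℝ)} (hP : IsPolytope P) :
    xc P ≤ vertexCount P := by
  classical
  obtain ⟨v, hv, -⟩ := exists_vertex_enumeration hP rfl
  obtain ⟨T, hT⟩ := exists_linearMap_apply_single v
  have hS : IsPolytope (convexHull ℝ
      (range fun i : Fin (vertexCount P) => (Pi.single i 1 : Fin (vertexCount P) → ℝ))) :=
    ⟨Finset.univ.image fun i => Pi.single i 1, by simp⟩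
  refine (exists_xc_eq (π := T.toAffineMap) hS ?_).1.trans (facetCount_convexHull_single_le _)
  rw [T.toAffineMap.image_convexHull, ← range_comp]
  exact (congrArg _ (congrArg range (funext hT))).trans hv.symm

end Projections

theorem xc_of_dim_plus_three (N d : ℕ) (P : Set (Fin N → ℝ))
    (hP : IsPolytope P) (hd : pdim P = d) (hv : vertexCount P = d + 3) :
    xc P = min (vertexCount P) (facetCount P) ∧
    (CombEquiv P (pyrK (d - 3) (prodP 1 2)) → xc P = d + 2) ∧
    (¬ CombEquiv P (pyrK (d - 3) (prodP 1 2)) → xc P = d + 3) := by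
  have hid : AffineMap.id ℝ (Fin N → ℝ) '' P = P := by simp
  obtain ⟨hle, e, Q, π, hQ, hπ, hxc⟩ := exists_xc_eq hP hid
  have hle' := xc_le_vertexCount hP
  by_cases h : CombEquiv P (pyrK (d - 3) (prodP 1 2))
  · obtain ⟨v, hPv, hvert⟩ := exists_vertex_enumeration hP hv
    have h3 : 3 ≤ d := by
      rw [pyrK_prism, hPv] at h
      have := card_le_of_combEquiv (fun i => hPv ▸ hvert i) pyrPrismVert_isVertexOf h
      simp at this
      omega
    have hf : facetCount P ≤ d + 2 :=
      (facetCount_le_of_combEquiv_pyrPrism h).trans (by omega)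
    have h1 := (combEquiv_of_facetCount_le hd hv hP hid hf).1
    have h2 := (combEquiv_of_facetCount_le hd hv hQ hπ (by omega)).1
    refine ⟨?_, fun _ => by omega, fun hn => absurd h hn⟩
    rw [hv, h1]
    omega
  · have h1 : d + 3 ≤ xc P := by
      by_contra! hlt
      exact h (combEquiv_of_facetCount_le hd hv hQ hπ (by omega)).2
    refine ⟨?_, fun hc => absurd hc h, fun _ => by omega⟩
    rw [hv, min_eq_left (by omega)]
    omega

end
end

section
/- Let P be a d-dimensional polytope with exactly d+4 vertices and at least d+4 facets. If there exists a polytope Q with fewer than d+4 facets and an affine map π with π(Q) = P, then Q is (d+1)-dimensional and has exactly d+3 facets. -/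
open Set

noncomputable section

section Polar

open Module

variable {E : Type*} [NormedAddCommGroup E] [InnerProductSpace ℝ E]

/-- The one-sided polar of a set in a real inner product space. -/
def innerPolar (S : Set E) : Set E := {a | ∀ s ∈ S, inner ℝ a s ≤ 1}

/-- The points of `S` lying on the hyperplane `⟪a, ·⟫ = 1`. -/
def activeSet (S : Set E) (a : E) : Set E := {s ∈ S | inner ℝ a s = 1}

/-- The points of the polar of `S` whose active points span the whole space.  If `0` is interior
to the convex hull of the finite set `S`, these are the normalized outer facet normals. -/
def facetNormals (S : Set E) : Set E :=
  {a ∈ innerPolar S | Submodule.span ℝ (activeSet S a) = ⊤}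

lemma inner_le_of_mem_convexHull {S : Set E} {a x : E} {r : ℝ} (h : ∀ s ∈ S, inner ℝ a s ≤ r)
    (hx : x ∈ convexHull ℝ S) : inner ℝ a x ≤ r :=
  convexHull_min (t := {x | inner ℝ a x ≤ r}) h
    (convex_halfSpace_le (innerSL ℝ a).isLinear r) hx

lemma inner_eq_of_mem_convexHull {S : Set E} {a x : E} {r : ℝ} (h : ∀ s ∈ S, inner ℝ a s = r)
    (hx : x ∈ convexHull ℝ S) : inner ℝ a x = r :=
  convexHull_min (t := {x | inner ℝ a x = r}) h
    (convex_hyperplane (innerSL ℝ a).isLinear r) hx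

lemma convex_innerPolar (S : Set E) : Convex ℝ (innerPolar S) := by
  intro a ha b hb s t hs ht hst x hx
  have h1 := mul_le_mul_of_nonneg_left (ha x hx) hs
  have h2 := mul_le_mul_of_nonneg_left (hb x hx) ht
  rw [inner_add_left, real_inner_smul_left, real_inner_smul_left]
  linarith

lemma isClosed_innerPolar (S : Set E) : IsClosed (innerPolar S) := by
  have : innerPolar S = ⋂ s ∈ S, {a : E | inner ℝ a s ≤ 1} := by
    ext a; simp [innerPolar]
  rw [this]
  exact isClosed_biInter fun s _ => isClosed_le (by fun_prop) continuous_const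

lemma zero_mem_interior_innerPolar {S : Set E} (hS : S.Finite) :
    (0 : E) ∈ interior (innerPolar S) := by
  rw [mem_interior_iff_mem_nhds]
  refine (hS.eventually_all (l := nhds (0 : E)) (p := fun s a => inner ℝ a s ≤ (1 : ℝ))).2 ?_
  intro s _
  have hc : Continuous fun a : E => (inner ℝ a s : ℝ) := by fun_prop
  exact (hc.continuousAt.eventually_lt continuousAt_const (by simp)).mono fun _ h => le_of_lt h

lemma isBounded_innerPolar {S : Set E} (h0 : (0 : E) ∈ interior (convexHull ℝ S)) :
    Bornology.IsBounded (innerPolar S) := by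
  obtain ⟨r, hr, hball⟩ := Metric.mem_nhds_iff.1 (mem_interior_iff_mem_nhds.1 h0)
  refine isBounded_iff_forall_norm_le.2 ⟨2 / r, fun a ha => ?_⟩
  by_cases hn : a = 0
  · subst hn; simp; positivity
  have hpos : 0 < ‖a‖ := norm_pos_iff.2 hn
  have hmem : (r / 2 / ‖a‖) • a ∈ convexHull ℝ S := by
    apply hball
    rw [mem_ball_zero_iff, norm_smul, Real.norm_of_nonneg (by positivity)]
    field_simp
    linarith
  have h := inner_le_of_mem_convexHull ha hmem
  rw [real_inner_smul_right, real_inner_self_eq_norm_sq] at h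
  rw [le_div_iff₀ hr]
  field_simp at h
  linarith

lemma eq_of_activeSet_eq {S : Set E} {a b : E} (ha : Submodule.span ℝ (activeSet S a) = ⊤)
    (h : activeSet S a = activeSet S b) : a = b := by
  refine ext_inner_right ℝ fun x => ?_
  have hx : x ∈ Submodule.span ℝ (activeSet S a) := ha ▸ Submodule.mem_top
  induction hx using Submodule.span_induction with
  | mem s hs => rw [hs.2, (h ▸ hs : s ∈ activeSet S b).2]
  | zero => simp
  | add x y _ _ hx hy => rw [inner_add_right, inner_add_right, hx, hy]
  | smul c x _ hx => rw [real_inner_smul_right, real_inner_smul_right, hx]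

lemma finite_facetNormals {S : Set E} (hS : S.Finite) : (facetNormals S).Finite := by
  refine Set.Finite.of_finite_image (f := activeSet S)
    (hS.finite_subsets.subset ?_) fun a ha b _ hab => eq_of_activeSet_eq ha.2 hab
  rintro _ ⟨a, _, rfl⟩
  exact fun s hs => hs.1

variable [FiniteDimensional ℝ E]

lemma span_activeSet_eq_top {S : Set E} (hS : S.Finite) {a : E}
    (ha : a ∈ (innerPolar S).extremePoints ℝ) : Submodule.span ℝ (activeSet S a) = ⊤ := by
  by_contra hne
  rw [← Submodule.orthogonal_eq_bot_iff] at hne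
  obtain ⟨w, hw, hw0⟩ := Submodule.exists_mem_ne_zero_of_ne_bot hne
  have key : ∀ u : E, (∀ s ∈ activeSet S a, inner ℝ u s = (0 : ℝ)) →
      ∀ᶠ t : ℝ in nhds 0, a + t • u ∈ innerPolar S := by
    intro u hu
    refine (hS.eventually_all (l := nhds (0 : ℝ))
      (p := fun s t => inner ℝ (a + t • u) s ≤ (1 : ℝ))).2 fun s hs => ?_
    rcases (ha.1 s hs).eq_or_lt with h | h
    · refine Filter.Eventually.of_forall fun t => ?_
      rw [inner_add_left, real_inner_smul_left, hu s ⟨hs, h⟩, h]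
      simp
    · have hc : Continuous fun t : ℝ => (inner ℝ (a + t • u) s : ℝ) := by fun_prop
      exact (hc.continuousAt.eventually_lt continuousAt_const (by simpa using h)).mono
        fun _ h => le_of_lt h
  have hw' : ∀ s ∈ activeSet S a, inner ℝ w s = (0 : ℝ) := fun s hs =>
    Submodule.inner_left_of_mem_orthogonal (Submodule.subset_span hs) hw
  have h2 := (key w hw').and (key (-w) fun s hs => by rw [inner_neg_left, hw' s hs, neg_zero])
  obtain ⟨t, ⟨ht1, ht2⟩, ht⟩ :=
    ((h2.filter_mono nhdsWithin_le_nhds).and (self_mem_nhdsWithin (s := Ioi (0 : ℝ)))).exists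
  have hseg : a ∈ openSegment ℝ (a + t • w) (a + t • (-w)) := by
    refine ⟨1 / 2, 1 / 2, by norm_num, by norm_num, by norm_num, ?_⟩
    module
  have := ha.2 ht1 ht2 hseg
  rw [add_eq_left, smul_eq_zero] at this
  exact this.elim (ne_of_gt ht) hw0

lemma innerPolar_subset_convexHull_facetNormals {S : Set E} (hS : S.Finite)
    (h0 : (0 : E) ∈ interior (convexHull ℝ S)) :
    innerPolar S ⊆ convexHull ℝ (facetNormals S) := by
  have hcomp : IsCompact (innerPolar S) :=
    Metric.isCompact_of_isClosed_isBounded (isClosed_innerPolar S) (isBounded_innerPolar h0)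
  have hKM := closure_convexHull_extremePoints hcomp (convex_innerPolar S)
  rw [← (finite_facetNormals hS).isClosed_convexHull (𝕜 := ℝ) |>.closure_eq]
  conv_lhs => rw [← hKM]
  exact closure_mono (convexHull_mono fun a ha => ⟨ha.1, span_activeSet_eq_top hS ha⟩)

lemma zero_mem_interior_convexHull_facetNormals {S : Set E} (hS : S.Finite)
    (h0 : (0 : E) ∈ interior (convexHull ℝ S)) :
    (0 : E) ∈ interior (convexHull ℝ (facetNormals S)) :=
  interior_mono (innerPolar_subset_convexHull_facetNormals hS h0) (zero_mem_interior_innerPolar hS)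

lemma finrank_add_one_le_ncard_facetNormals {S : Set E} (hS : S.Finite)
    (h0 : (0 : E) ∈ interior (convexHull ℝ S)) :
    finrank ℝ E + 1 ≤ (facetNormals S).ncard := by
  have h0' := zero_mem_interior_convexHull_facetNormals hS h0
  have htop := interior_convexHull_nonempty_iff_affineSpan_eq_top.1 ⟨_, h0'⟩
  have := (finite_facetNormals hS).fintype
  have : Nonempty (facetNormals S) :=
    (convexHull_nonempty_iff.1 ⟨_, interior_subset h0'⟩).to_subtype
  have h := finrank_vectorSpan_range_add_one_le ℝ (Subtype.val : facetNormals S → E)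
  rwa [Subtype.range_coe, ← direction_affineSpan, htop, AffineSubspace.direction_top, finrank_top,
    ← Nat.card_eq_fintype_card, Nat.card_coe_set_eq] at h

lemma innerPolar_facetNormals {S : Set E} (hS : S.Finite)
    (h0 : (0 : E) ∈ interior (convexHull ℝ S)) :
    innerPolar (facetNormals S) = convexHull ℝ S := by
  refine subset_antisymm (fun x hx => ?_) fun x hx a ha => ?_
  · by_contra hxS
    obtain ⟨f, u, hfu, hux⟩ := geometric_hahn_banach_closed_point (convex_convexHull ℝ S)
      (hS.isClosed_convexHull (𝕜 := ℝ)) hxS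
    have hu : 0 < u := by simpa using hfu 0 (interior_subset h0)
    set a : E := u⁻¹ • (InnerProductSpace.toDual ℝ E).symm f with ha_def
    have ha : ∀ y, inner ℝ a y = u⁻¹ * f y := fun y => by
      rw [ha_def, real_inner_smul_left, InnerProductSpace.toDual_symm_apply]
    have haS : a ∈ innerPolar S := fun s hs => by
      rw [ha, inv_mul_le_iff₀ hu, mul_one]
      exact (hfu s (subset_convexHull ℝ S hs)).le
    have h1 := inner_le_of_mem_convexHull hx
      (innerPolar_subset_convexHull_facetNormals hS h0 haS)
    rw [real_inner_comm, ha, inv_mul_le_iff₀ hu, mul_one] at h1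
    linarith
  · rw [real_inner_comm]
    exact inner_le_of_mem_convexHull ha.1 hx

lemma ncard_extremePoints_le {S : Set E} (hS : S.Finite)
    (h0 : (0 : E) ∈ interior (convexHull ℝ S))
    (hcard : (facetNormals S).ncard ≤ finrank ℝ E + 1) :
    ((convexHull ℝ S).extremePoints ℝ).ncard ≤ finrank ℝ E + 1 := by
  have hfin := finite_facetNormals hS
  have hspan : ∀ v ∈ (convexHull ℝ S).extremePoints ℝ,
      Submodule.span ℝ (activeSet (facetNormals S) v) = ⊤ := fun v hv => by
    rw [← innerPolar_facetNormals hS h0] at hv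
    exact span_activeSet_eq_top hfin hv
  have hmiss : ∀ v ∈ (convexHull ℝ S).extremePoints ℝ,
      ∃ a ∈ facetNormals S, activeSet (facetNormals S) v = facetNormals S \ {a} := by
    intro v hv
    have hsub : activeSet (facetNormals S) v ⊆ facetNormals S := fun s hs => hs.1
    have hlt : ¬ facetNormals S ⊆ activeSet (facetNormals S) v := fun hall => by
      have := inner_eq_of_mem_convexHull (fun s hs => (hall hs).2)
        (interior_subset (zero_mem_interior_convexHull_facetNormals hS h0))
      simp at this
    obtain ⟨a, ha, hav⟩ := Set.not_subset.1 hlt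
    refine ⟨a, ha, Set.eq_of_subset_of_ncard_le (fun s hs => ⟨hsub hs, ?_⟩) ?_ hfin.sdiff⟩
    · rintro rfl; exact hav hs
    · have := (hfin.subset hsub).fintype
      have h := finrank_span_le_card (R := ℝ) (activeSet (facetNormals S) v)
      rw [hspan v hv, finrank_top, ← Set.ncard_eq_toFinset_card'] at h
      rw [Set.ncard_sdiff_singleton_of_mem ha]
      omega
  choose! f hf hfa using hmiss
  refine le_trans (Set.ncard_le_ncard_of_injOn f hf (fun v hv w hw hvw => ?_) hfin) hcard
  exact eq_of_activeSet_eq (hspan v hv) (by rw [hfa v hv, hfa w hw, hvw])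

lemma finrank_vectorSpan_facet_add_one {S : Set E} {a : E} (ha : a ∈ facetNormals S)
    (hE : 0 < finrank ℝ E) :
    {y ∈ convexHull ℝ S | inner ℝ a y = 1}.Nonempty ∧
    finrank ℝ (vectorSpan ℝ {y ∈ convexHull ℝ S | inner ℝ a y = 1}) + 1 = finrank ℝ E := by
  set A := {y ∈ convexHull ℝ S | inner ℝ a y = 1}
  have hact : activeSet S a ⊆ A := fun s hs => ⟨subset_convexHull ℝ S hs.1, hs.2⟩
  have hne : (activeSet S a).Nonempty := by
    rw [Set.nonempty_iff_ne_empty]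
    intro h
    have := ha.2
    rw [h, Submodule.span_empty] at this
    have h2 := finrank_top ℝ E
    rw [← this, finrank_bot] at h2
    omega
  obtain ⟨s₀, hs₀⟩ := hne
  refine ⟨⟨s₀, hact hs₀⟩, ?_⟩
  have hle : vectorSpan ℝ A ≤ (Submodule.span ℝ {a})ᗮ := by
    rw [vectorSpan, Submodule.span_le]
    rintro _ ⟨x, hx, y, hy, rfl⟩
    rw [SetLike.mem_coe, Submodule.mem_orthogonal_singleton_iff_inner_right]
    change inner ℝ a (x - y) = 0
    rw [inner_sub_right, hx.2, hy.2, sub_self]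
  have ha0 : a ≠ 0 := by
    rintro rfl
    have := hs₀.2
    simp at this
  have h1 := Submodule.finrank_add_finrank_orthogonal (Submodule.span ℝ {a})
  rw [finrank_span_singleton ha0] at h1
  have h2 := Submodule.finrank_mono hle
  have htop : vectorSpan ℝ A ⊔ Submodule.span ℝ {s₀} = ⊤ := by
    rw [eq_top_iff, ← ha.2, Submodule.span_le]
    intro s hs
    rw [← sub_add_cancel s s₀]
    exact Submodule.add_mem_sup (vsub_mem_vectorSpan ℝ (hact hs) (hact hs₀))
      (Submodule.mem_span_singleton_self s₀)
  have h3 := Submodule.finrank_add_le_finrank_add_finrank (vectorSpan ℝ A)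
    (Submodule.span ℝ {s₀})
  rw [htop, finrank_top] at h3
  have h4 := finrank_span_le_card (R := ℝ) ({s₀} : Set E)
  simp only [Set.toFinset_singleton, Finset.card_singleton] at h4
  omega

end Polar

section Polytope

open Module

lemma pdim_eq_finrank_vectorSpan {N : ℕ} {A : Set (Fin N → ℝ)} (hA : A.Nonempty) :
    pdim A = finrank ℝ (vectorSpan ℝ A) := by
  rw [pdim, if_pos hA, direction_affineSpan]

lemma nonempty_of_pdim_eq {N d : ℕ} {A : Set (Fin N → ℝ)} (hA : pdim A = d) : A.Nonempty := by
  by_contra h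
  rw [pdim, if_neg h] at hA
  omega

lemma pdim_image_of_injective {N : ℕ} {V : Type*} [AddCommGroup V] [Module ℝ V]
    (g : V →ᵃ[ℝ] (Fin N → ℝ)) (hg : Function.Injective g) {A : Set V} (hA : A.Nonempty) :
    pdim (g '' A) = finrank ℝ (vectorSpan ℝ A) := by
  rw [pdim_eq_finrank_vectorSpan (hA.image g), ← AffineMap.map_vectorSpan,
    (Submodule.equivMapOfInjective g.linear (g.linear_injective_iff.2 hg) _).finrank_eq]

lemma exists_sum_mul_eq {N : ℕ} (f : (Fin N → ℝ) →ₗ[ℝ] ℝ) :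
    ∃ c : Fin N → ℝ, ∀ x, ∑ i, c i * x i = f x := by
  refine ⟨fun i => f (Pi.single i 1), fun x => ?_⟩
  rw [LinearMap.pi_apply_eq_sum_univ f x]
  refine Finset.sum_congr rfl fun i _ => ?_
  rw [smul_eq_mul, mul_comm]
  refine congrArg (x i * ·) (congrArg f (funext fun j => ?_))
  simp [Pi.single_apply, eq_comm]

/-- A face of the convex hull of `S` is determined by the points of `S` it contains. -/
lemma IsFaceOf.subset_of_inter_subset {N : ℕ} {S : Finset (Fin N → ℝ)} {F G : Set (Fin N → ℝ)}
    (hF : IsFaceOf F (convexHull ℝ (S : Set (Fin N → ℝ))))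
    (hG : IsFaceOf G (convexHull ℝ (S : Set (Fin N → ℝ))))
    (h : ↑S ∩ F ⊆ ↑S ∩ G) : F ⊆ G := by
  obtain ⟨c, b, hcb, rfl⟩ := hF
  obtain ⟨c', b', -, rfl⟩ := hG
  rintro x ⟨hx, hxb⟩
  refine ⟨hx, ?_⟩
  obtain ⟨w, hw0, hw1, rfl⟩ := Finset.mem_convexHull'.1 hx
  have hlin : ∀ (c : Fin N → ℝ) (b : ℝ), ∑ i, c i * (∑ s ∈ S, w s • s) i - b
      = ∑ s ∈ S, w s * (∑ i, c i * s i - b) := by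
    intro c b
    simp only [Finset.sum_apply, Pi.smul_apply, smul_eq_mul, mul_sub, Finset.sum_sub_distrib,
      Finset.mul_sum, ← Finset.sum_mul, hw1, one_mul]
    rw [Finset.sum_comm]
    congr 1
    exact Finset.sum_congr rfl fun s _ => Finset.sum_congr rfl fun i _ => by ring
  have hz : ∀ s ∈ S, w s * (∑ i, c i * s i - b) = 0 := by
    refine (Finset.sum_eq_zero_iff_of_nonpos fun s hs => ?_).1 (by rw [← hlin, hxb, sub_self])
    exact mul_nonpos_of_nonneg_of_nonpos (hw0 s hs)
      (sub_nonpos.2 (hcb s (subset_convexHull ℝ _ hs)))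
  rw [← sub_eq_zero, hlin]
  refine Finset.sum_eq_zero fun s hs => ?_
  rcases mul_eq_zero.1 (hz s hs) with h0 | h0
  · rw [h0, zero_mul]
  · have := (h ⟨hs, subset_convexHull ℝ _ hs, sub_eq_zero.1 h0⟩).2.2
    rw [this, sub_self, mul_zero]

lemma IsPolytope.finite_faces {N : ℕ} {Q : Set (Fin N → ℝ)} (hQ : IsPolytope Q) :
    {F | IsFaceOf F Q}.Finite := by
  obtain ⟨S, rfl⟩ := hQ
  refine Set.Finite.of_finite_image (f := fun F => (S : Set (Fin N → ℝ)) ∩ F)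
    (S.finite_toSet.finite_subsets.subset ?_) fun F hF G hG hFG => ?_
  · rintro _ ⟨F, _, rfl⟩
    exact Set.inter_subset_left
  · exact (hF.subset_of_inter_subset hG hFG.subset).antisymm
      (hG.subset_of_inter_subset hF hFG.superset)

lemma IsPolytope.finite_facets {N : ℕ} {Q : Set (Fin N → ℝ)} (hQ : IsPolytope Q) :
    {F | IsFacetOf F Q}.Finite :=
  hQ.finite_faces.subset fun _ hF => hF.1

/-- A `D`-polytope is an affine copy of a polytope in `ℝ^D` with the origin in its interior. -/
lemma IsPolytope.exists_chart {N D : ℕ} {Q : Set (Fin N → ℝ)} (hQ : IsPolytope Q)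
    (hD : pdim Q = D) :
    ∃ (g : EuclideanSpace ℝ (Fin D) →ᵃ[ℝ] (Fin N → ℝ)) (S : Set (EuclideanSpace ℝ (Fin D))),
      Function.Injective g ∧ S.Finite ∧ Q = g '' convexHull ℝ S ∧
        0 ∈ interior (convexHull ℝ S) := by
  obtain ⟨p, hp⟩ := nonempty_of_pdim_eq hD
  rw [pdim_eq_finrank_vectorSpan ⟨p, hp⟩, Nat.cast_inj] at hD
  obtain ⟨T₀, hT₀⟩ := hQ
  let φ : EuclideanSpace ℝ (Fin D) ≃ₗ[ℝ] vectorSpan ℝ Q :=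
    LinearEquiv.ofFinrankEq _ _ (by rw [hD, finrank_euclideanSpace_fin])
  let g : EuclideanSpace ℝ (Fin D) →ᵃ[ℝ] (Fin N → ℝ) :=
    ((vectorSpan ℝ Q).subtype ∘ₗ φ.toLinearMap).toAffineMap + AffineMap.const ℝ _ p
  have hgapp : ∀ y, g y = (φ y : Fin N → ℝ) + p := fun y => rfl
  have hg : Function.Injective g := fun x y hxy => by
    rw [hgapp, hgapp, add_left_inj, Subtype.coe_inj] at hxy
    exact φ.injective hxy
  have hrange : ∀ q ∈ Q, ∃ y, g y = q := fun q hq => by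
    refine ⟨φ.symm ⟨q - p, vsub_mem_vectorSpan ℝ hq hp⟩, ?_⟩
    rw [hgapp, LinearEquiv.apply_symm_apply, sub_add_cancel]
  set T : Set (EuclideanSpace ℝ (Fin D)) := g ⁻¹' T₀
  have hTfin : T.Finite := T₀.finite_toSet.preimage hg.injOn
  have hgT : g '' T = T₀ := Set.image_preimage_eq_of_subset fun q hq =>
    hrange q (hT₀ ▸ subset_convexHull ℝ _ hq)
  have hQT : Q = g '' convexHull ℝ T := by rw [AffineMap.image_convexHull, hgT, hT₀]
  have hspan : vectorSpan ℝ (convexHull ℝ T) = ⊤ := by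
    apply Submodule.eq_top_of_finrank_eq
    have h := AffineMap.map_vectorSpan g (s := convexHull ℝ T)
    rw [← hQT] at h
    have h2 := Submodule.finrank_map_le g.linear (vectorSpan ℝ (convexHull ℝ T))
    rw [h, hD] at h2
    have h3 := Submodule.finrank_le (vectorSpan ℝ (convexHull ℝ T))
    rw [finrank_euclideanSpace_fin] at h3 ⊢
    omega
  have hTne : (convexHull ℝ T).Nonempty := by
    rw [hQT] at hp
    exact Set.Nonempty.of_image ⟨p, hp⟩
  have haff : affineSpan ℝ T = ⊤ := by
    rw [← affineSpan_convexHull]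
    exact (AffineSubspace.affineSpan_eq_top_iff_vectorSpan_eq_top_of_nonempty ℝ _ _ hTne).2 hspan
  obtain ⟨y₀, hy₀⟩ := interior_convexHull_nonempty_iff_affineSpan_eq_top.2 haff
  let τ := AffineEquiv.constVAdd ℝ (EuclideanSpace ℝ (Fin D)) y₀
  have hτ : τ '' (τ.symm '' convexHull ℝ T) = convexHull ℝ T := by
    rw [Set.image_image]; simp
  have hconv : convexHull ℝ (τ.symm '' T) = τ.symm '' convexHull ℝ T :=
    (AffineMap.image_convexHull τ.symm.toAffineMap T).symm
  refine ⟨g.comp τ.toAffineMap, τ.symm '' T, hg.comp τ.injective, hTfin.image _, ?_, ?_⟩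
  · rw [hconv, AffineMap.coe_comp, Set.image_comp]
    exact hQT.trans (by rw [AffineEquiv.coe_toAffineMap, hτ])
  · have hhomeo : τ.symm '' convexHull ℝ T = Homeomorph.addLeft (-y₀) '' convexHull ℝ T := rfl
    rw [hconv, hhomeo, ← Homeomorph.image_interior]
    exact ⟨y₀, hy₀, by simp⟩

lemma extremePoints_image_subset {V W : Type*} [AddCommGroup V] [Module ℝ V] [AddCommGroup W]
    [Module ℝ W] (g : V →ᵃ[ℝ] W) (hg : Function.Injective g) (C : Set V) :
    (g '' C).extremePoints ℝ ⊆ g '' C.extremePoints ℝ := by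
  rintro _ ⟨⟨y, hy, rfl⟩, hext⟩
  refine ⟨y, ⟨hy, fun x hx z hz hyxz => hg (hext ⟨x, hx, rfl⟩ ⟨z, hz, rfl⟩ ?_)⟩, rfl⟩
  rw [← image_openSegment]
  exact ⟨y, hyxz, rfl⟩

lemma isFacetOf_image_of_mem_facetNormals {N D : ℕ} (hD : 0 < D)
    (g : EuclideanSpace ℝ (Fin D) →ᵃ[ℝ] (Fin N → ℝ)) (hg : Function.Injective g)
    {S : Set (EuclideanSpace ℝ (Fin D))} {a : EuclideanSpace ℝ (Fin D)}
    (ha : a ∈ facetNormals S) (hdim : pdim (g '' convexHull ℝ S) = D) :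
    IsFacetOf (g '' {y ∈ convexHull ℝ S | inner ℝ a y = 1}) (g '' convexHull ℝ S) := by
  obtain ⟨hne, hrank⟩ := finrank_vectorSpan_facet_add_one ha (by simpa using hD)
  refine ⟨?_, ?_⟩
  · obtain ⟨M, hM⟩ := g.linear.exists_leftInverse_of_injective
      (LinearMap.ker_eq_bot.2 (g.linear_injective_iff.2 hg))
    obtain ⟨c, hc⟩ := exists_sum_mul_eq ((innerSL ℝ a).toLinearMap ∘ₗ M)
    have hcg : ∀ y, ∑ i, c i * g y i = inner ℝ a y + ∑ i, c i * g 0 i := fun y => by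
      have hM' : M (g.linear y) = y := LinearMap.congr_fun hM y
      have hy : g y = g.linear y + g 0 := by simpa using g.map_vadd 0 y
      rw [hc, hc, hy, map_add]
      simp [hM']
    refine ⟨c, 1 + ∑ i, c i * g 0 i, ?_, ?_⟩
    · rintro _ ⟨y, hy, rfl⟩
      rw [hcg]
      gcongr
      exact inner_le_of_mem_convexHull ha.1 hy
    · ext x
      constructor
      · rintro ⟨y, ⟨hy, hy1⟩, rfl⟩
        exact ⟨⟨y, hy, rfl⟩, by rw [hcg, hy1]⟩
      · rintro ⟨⟨y, hy, rfl⟩, hx⟩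
        rw [hcg, add_left_inj] at hx
        exact ⟨y, ⟨hy, hx⟩, rfl⟩
  · rw [pdim_image_of_injective g hg hne, hdim]
    rw [finrank_euclideanSpace_fin] at hrank
    exact_mod_cast hrank

/-- A polytope of positive dimension `D` has at least `D + 1` facets, and if it has exactly
`D + 1` facets, then it has at most `D + 1` extreme points. -/
lemma IsPolytope.add_one_le_facetCount {N D : ℕ} {Q : Set (Fin N → ℝ)} (hQ : IsPolytope Q)
    (hD : pdim Q = D) (hpos : 0 < D) :
    D + 1 ≤ facetCount Q ∧
      (facetCount Q ≤ D + 1 → (Q.extremePoints ℝ).ncard ≤ D + 1) := by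
  have hfin := hQ.finite_facets
  obtain ⟨g, S, hg, hS, rfl, h0⟩ := hQ.exists_chart hD
  have hle : (facetNormals S).ncard ≤ facetCount (g '' convexHull ℝ S) := by
    refine Set.ncard_le_ncard_of_injOn
      (fun a => g '' {y ∈ convexHull ℝ S | inner ℝ a y = 1})
      (fun a ha => isFacetOf_image_of_mem_facetNormals hpos g hg ha hD)
      (fun a ha b hb hab => eq_of_activeSet_eq ha.2 ?_) hfin
    have h := hg.image_injective hab
    ext s
    have hs := Set.ext_iff.1 h s
    exact and_congr_right fun hsS => by simpa [subset_convexHull ℝ S hsS] using hs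
  have hrank := finrank_add_one_le_ncard_facetNormals hS h0
  rw [finrank_euclideanSpace_fin] at hrank
  refine ⟨hrank.trans hle, fun hcard => ?_⟩
  have hext := ncard_extremePoints_le hS h0
    (by rw [finrank_euclideanSpace_fin]; exact hle.trans hcard)
  rw [finrank_euclideanSpace_fin] at hext
  have hSfin : ((convexHull ℝ S).extremePoints ℝ).Finite :=
    hS.subset extremePoints_convexHull_subset
  exact (Set.ncard_le_ncard (extremePoints_image_subset g hg _) (hSfin.image g)).trans
    ((Set.ncard_image_le hSfin).trans hext)

lemma exists_extremePoint_of_isVertexOf {e N : ℕ} {Q : Set (Fin e → ℝ)} (hQ : IsPolytope Q)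
    (π : (Fin e → ℝ) →ᵃ[ℝ] (Fin N → ℝ)) {v : Fin N → ℝ} (hv : IsVertexOf v (π '' Q)) :
    ∃ x ∈ Q.extremePoints ℝ, π x = v := by
  obtain ⟨c, b, hcb, hvb⟩ := hv
  have hmem : ∀ x, x = v ↔ x ∈ π '' Q ∧ ∑ i, c i * x i = b := fun x => Set.ext_iff.1 hvb x
  obtain ⟨⟨q, hq, hqv⟩, hvb⟩ := (hmem v).1 rfl
  have hcont : Continuous π := π.continuous_of_finiteDimensional
  have hcomp : IsCompact Q := by
    obtain ⟨S, rfl⟩ := hQ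
    exact S.finite_toSet.isCompact_convexHull (𝕜 := ℝ)
  have hfib : IsCompact (Q ∩ π ⁻¹' {v}) :=
    hcomp.inter_right (isClosed_singleton.preimage hcont)
  obtain ⟨x, hx⟩ := hfib.extremePoints_nonempty ⟨q, hq, hqv⟩
  refine ⟨x, IsExtreme.extremePoints_subset_extremePoints
    (⟨Set.inter_subset_left, ?_⟩ : IsExtreme ℝ Q (Q ∩ π ⁻¹' {v})) hx, hx.1.2⟩
  rintro y hy z hz w ⟨hw, hwv⟩ ⟨s, t, hs, ht, hst, rfl⟩
  refine ⟨hy, (hmem _).2 ⟨⟨y, hy, rfl⟩, ?_⟩⟩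
  have h1 := hcb _ ⟨y, hy, rfl⟩
  have h2 := hcb _ ⟨z, hz, rfl⟩
  have hπ : π (s • y + t • z) = s • π y + t • π z := Convex.combo_affine_apply hst
  rw [Set.mem_preimage, Set.mem_singleton_iff, hπ] at hwv
  rw [← hwv] at hvb
  have h3 : s * ∑ i, c i * π y i + t * ∑ i, c i * π z i = b := by
    rw [← hvb, Finset.mul_sum, Finset.mul_sum, ← Finset.sum_add_distrib]
    exact Finset.sum_congr rfl fun i _ => by simp; ring
  refine le_antisymm h1 ?_
  by_contra! hlt
  have h4 := mul_lt_mul_of_pos_left hlt hs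
  have h5 := mul_le_mul_of_nonneg_left h2 ht.le
  have h6 : s * b + t * b = b := by rw [← add_mul, hst, one_mul]
  linarith

lemma vertexCount_image_le {e N : ℕ} {Q : Set (Fin e → ℝ)} (hQ : IsPolytope Q)
    (π : (Fin e → ℝ) →ᵃ[ℝ] (Fin N → ℝ)) :
    vertexCount (π '' Q) ≤ (Q.extremePoints ℝ).ncard := by
  have hfin : (Q.extremePoints ℝ).Finite := by
    obtain ⟨S, rfl⟩ := hQ
    exact S.finite_toSet.subset extremePoints_convexHull_subset
  exact (Set.ncard_le_ncard (fun v hv => exists_extremePoint_of_isVertexOf hQ π hv)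
    (hfin.image π)).trans (Set.ncard_image_le hfin)

lemma pdim_image_le {e N : ℕ} (π : (Fin e → ℝ) →ᵃ[ℝ] (Fin N → ℝ)) {Q : Set (Fin e → ℝ)}
    (hQ : Q.Nonempty) : pdim (π '' Q) ≤ pdim Q := by
  rw [pdim_eq_finrank_vectorSpan hQ, pdim_eq_finrank_vectorSpan (hQ.image π),
    ← AffineMap.map_vectorSpan]
  exact_mod_cast Submodule.finrank_map_le _ _

/-- An affine map that preserves the dimension of `Q` preserves the dimension of its subsets. -/
lemma pdim_image_of_subset {e N : ℕ} (π : (Fin e → ℝ) →ᵃ[ℝ] (Fin N → ℝ))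
    {A Q : Set (Fin e → ℝ)} (hAQ : A ⊆ Q) (hdim : pdim (π '' Q) = pdim Q) :
    pdim (π '' A) = pdim A := by
  rcases A.eq_empty_or_nonempty with rfl | hA
  · simp [pdim]
  have hQ := hA.mono hAQ
  rw [pdim_eq_finrank_vectorSpan hQ, pdim_eq_finrank_vectorSpan (hQ.image π),
    ← AffineMap.map_vectorSpan, Nat.cast_inj] at hdim
  rw [pdim_eq_finrank_vectorSpan hA, pdim_eq_finrank_vectorSpan (hA.image π),
    ← AffineMap.map_vectorSpan, Nat.cast_inj]
  have hrn : ∀ W : Submodule ℝ (Fin e → ℝ),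
      finrank ℝ (W.map π.linear) + finrank ℝ (W ⊓ π.linear.ker : Submodule ℝ (Fin e → ℝ))
        = finrank ℝ W := fun W => by
    have h := (π.linear.domRestrict W).finrank_range_add_finrank_ker
    rwa [LinearMap.range_domRestrict, LinearMap.ker_domRestrict,
      ← Submodule.finrank_map_subtype_eq, Submodule.map_comap_subtype] at h
  have h1 := hrn (vectorSpan ℝ A)
  have h2 := hrn (vectorSpan ℝ Q)
  have h3 : finrank ℝ (vectorSpan ℝ A ⊓ π.linear.ker : Submodule ℝ (Fin e → ℝ)) ≤
      finrank ℝ (vectorSpan ℝ Q ⊓ π.linear.ker : Submodule ℝ (Fin e → ℝ)) :=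
    Submodule.finrank_mono (inf_le_inf_right _ (vectorSpan_mono ℝ hAQ))
  omega

lemma facetCount_image_le {e N : ℕ} {Q : Set (Fin e → ℝ)} (hQ : IsPolytope Q)
    (π : (Fin e → ℝ) →ᵃ[ℝ] (Fin N → ℝ)) (hdim : pdim (π '' Q) = pdim Q) :
    facetCount (π '' Q) ≤ facetCount Q := by
  have himg : ∀ F, IsFacetOf F (π '' Q) → π '' (Q ∩ π ⁻¹' F) = F := by
    rintro F ⟨⟨c, b, -, rfl⟩, -⟩
    rw [Set.image_inter_preimage]
    exact Set.inter_eq_right.2 fun x hx => hx.1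
  refine Set.ncard_le_ncard_of_injOn (fun F => Q ∩ π ⁻¹' F) (fun F hF => ⟨?_, ?_⟩)
    (fun F hF G hG hFG => ?_) hQ.finite_facets
  · obtain ⟨⟨c, b, hcb, rfl⟩, -⟩ := hF
    obtain ⟨f, hf⟩ : ∃ f : (Fin N → ℝ) →ₗ[ℝ] ℝ, ∀ x, f x = ∑ i, c i * x i :=
      ⟨∑ i, c i • LinearMap.proj i, fun x => by simp⟩
    obtain ⟨c', hc'⟩ := exists_sum_mul_eq (f ∘ₗ π.linear)
    have hval : ∀ x, ∑ i, c i * π x i = ∑ i, c' i * x i + f (π 0) := fun x => by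
      have hx : π x = π.linear x + π 0 := by simpa using π.map_vadd 0 x
      rw [hc', ← hf, hx, map_add, LinearMap.comp_apply]
    refine ⟨c', b - f (π 0), fun x hx => ?_, ?_⟩
    · have := hcb _ ⟨x, hx, rfl⟩
      rw [hval] at this
      linarith
    · ext x
      refine and_congr_right fun hx => ?_
      rw [Set.mem_preimage, Set.mem_ofPred_eq, hval, eq_sub_iff_add_eq]
      exact and_iff_right ⟨x, hx, rfl⟩
  · have h := pdim_image_of_subset π (A := Q ∩ π ⁻¹' F) Set.inter_subset_left hdim
    rw [himg F hF] at h
    rw [← h, ← hdim, hF.2]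
  · rw [← himg F hF, ← himg G hG]
    exact congrArg (π '' ·) hFG

end Polytope

theorem small_extension_is_codimension_one (N d : ℕ) (P : Set (Fin N → ℝ))
    (hP : IsPolytope P) (hd : pdim P = d)
    (hv : vertexCount P = d + 4) (hf : d + 4 ≤ facetCount P)
    (e : ℕ) (Q : Set (Fin e → ℝ)) (π : (Fin e → ℝ) →ᵃ[ℝ] (Fin N → ℝ))
    (hQ : IsPolytope Q) (hproj : π '' Q = P) (hQfew : facetCount Q < d + 4) :
    pdim Q = d + 1 ∧ facetCount Q = d + 3 := by
  subst hproj
  have hne : Q.Nonempty := (nonempty_of_pdim_eq hd).of_image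
  obtain ⟨D, hD⟩ : ∃ D : ℕ, pdim Q = D := ⟨_, pdim_eq_finrank_vectorSpan hne⟩
  have hle := pdim_image_le π hne
  have hlt : d ≠ D := by
    rintro rfl
    have := facetCount_image_le hQ π (hd.trans hD.symm)
    omega
  have hvert := vertexCount_image_le hQ π
  obtain ⟨hfacets, hsimplex⟩ := hQ.add_one_le_facetCount hD (by omega)
  have hmany : ¬ facetCount Q ≤ D + 1 := fun h => by
    have := hsimplex h
    omega
  omega

end
end
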